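/- Let n ≥ 2 be an integer and α ∈ ℝ with α ≠ 4-n, and set γ = (n-4+α)(n-α)/4 and h = ((n-4+α)/2)². Assume γ ≤ 2h. Then the infimum, over all functions u : ℝⁿ → ℝ of class C² with compact support contained in ℝⁿ \ {0} and with ∫_{ℝⁿ} |x|^{α-2} |∇u(x)|² dx ≠ 0, of the quotient (∫_{ℝⁿ} |x|^α |Δu(x)|² dx) / (∫_{ℝⁿ} |x|^{α-2} |∇u(x)|² dx) equals the infimum over integers k ≥ 0 of (γ + k(n-2+k))² / (h + k(n-2+k)). -/

import Mathlib

open MeasureTheory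

noncomputable def lap {n : ℕ} (u : EuclideanSpace ℝ (Fin n) → ℝ)
    (x : EuclideanSpace ℝ (Fin n)) : ℝ :=
  ∑ i : Fin n, iteratedFDeriv ℝ 2 u x ![EuclideanSpace.single i 1, EuclideanSpace.single i 1]

/-! ### The Weyl algebra relations -/

section Weyl

variable {ι A : Type*} [Fintype ι] [DecidableEq ι] [Ring A] {x d : ι → A}

theorem weyl_d_mul_euler (hdd : ∀ i j, d i * d j = d j * d i)
    (hdx : ∀ i j, d i * x j = x j * d i + if i = j then 1 else 0) (j : ι) :
    d j * ∑ i, x i * d i = (∑ i, x i * d i) * d j + d j := by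
  simp only [Finset.mul_sum, Finset.sum_mul, ← mul_assoc, hdx, add_mul, ite_mul, one_mul, zero_mul,
    Finset.sum_add_distrib, Finset.sum_ite_eq, Finset.mem_univ, if_true]
  congr 1
  exact Finset.sum_congr rfl fun i _ => by rw [mul_assoc, hdd, mul_assoc]

theorem weyl_euler_mul_x (hxx : ∀ i j, x i * x j = x j * x i)
    (hdx : ∀ i j, d i * x j = x j * d i + if i = j then 1 else 0) (j : ι) :
    (∑ i, x i * d i) * x j = x j * (∑ i, x i * d i) + x j := by
  simp only [Finset.mul_sum, Finset.sum_mul, mul_assoc, hdx, mul_add, mul_ite, mul_one, mul_zero,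
    Finset.sum_add_distrib, Finset.sum_ite_eq', Finset.mem_univ, if_true]
  congr 1
  exact Finset.sum_congr rfl fun i _ => by rw [← mul_assoc, hxx, mul_assoc]

theorem weyl_lap_mul_euler (hdd : ∀ i j, d i * d j = d j * d i)
    (hdx : ∀ i j, d i * x j = x j * d i + if i = j then 1 else 0) :
    (∑ i, d i * d i) * ∑ i, x i * d i
      = (∑ i, x i * d i) * (∑ i, d i * d i) + 2 * ∑ i, d i * d i := by
  rw [Finset.sum_mul, Finset.mul_sum, Finset.mul_sum, ← Finset.sum_add_distrib]
  refine Finset.sum_congr rfl fun j _ => ?_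
  have h := weyl_d_mul_euler hdd hdx j
  set T := ∑ i, x i * d i
  rw [mul_assoc, h, mul_add, ← mul_assoc, h]
  noncomm_ring

theorem weyl_euler_mul_sq (hxx : ∀ i j, x i * x j = x j * x i)
    (hdx : ∀ i j, d i * x j = x j * d i + if i = j then 1 else 0) :
    (∑ i, x i * d i) * (∑ i, x i * x i)
      = (∑ i, x i * x i) * (∑ i, x i * d i) + 2 * ∑ i, x i * x i := by
  rw [Finset.sum_mul _ _ (∑ i, x i * d i), Finset.mul_sum, Finset.mul_sum,
    ← Finset.sum_add_distrib]
  refine Finset.sum_congr rfl fun j _ => ?_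
  have h := weyl_euler_mul_x hxx hdx j
  set T := ∑ i, x i * d i
  rw [← mul_assoc, h, add_mul, mul_assoc, h]
  noncomm_ring

theorem weyl_lap_mul_sq
    (hdx : ∀ i j, d i * x j = x j * d i + if i = j then 1 else 0) :
    (∑ i, d i * d i) * (∑ i, x i * x i)
      = (∑ i, x i * x i) * (∑ i, d i * d i) + 4 * (∑ i, x i * d i)
        + 2 * (Fintype.card ι : A) := by
  have key : ∀ j, d j * (∑ i, x i * x i) = (∑ i, x i * x i) * d j + 2 * x j := by
    intro j
    simp only [Finset.mul_sum, Finset.sum_mul]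
    have : ∀ i, d j * (x i * x i) = x i * x i * d j + if j = i then 2 * x i else 0 := by
      intro i
      rw [← mul_assoc, hdx, add_mul, mul_assoc, hdx]
      split_ifs <;> noncomm_ring
    simp only [this, Finset.sum_add_distrib, Finset.sum_ite_eq, Finset.mem_univ, if_true]
  rw [Finset.sum_mul]
  have : ∀ j, d j * d j * (∑ i, x i * x i)
      = (∑ i, x i * x i) * (d j * d j) + 4 * (x j * d j) + 2 := by
    intro j
    rw [mul_assoc, key, mul_add, ← mul_assoc, key]
    have h2 : d j * (2 * x j) = 2 * (d j * x j) := by noncomm_ring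
    rw [h2, hdx, if_pos rfl]
    noncomm_ring
    rw [two_zsmul, one_add_one_eq_two]
  rw [Finset.sum_congr rfl fun j _ => this j]
  simp only [Finset.sum_add_distrib, ← Finset.mul_sum, Finset.sum_const, Finset.card_univ,
    nsmul_eq_mul]
  congr 1
  exact (Nat.cast_commute _ _).eq

theorem weyl_angular_mul_euler {T R D c : A} (hDT : D * T = T * D + 2 * D)
    (hTR : T * R = R * T + 2 * R) (hc : Commute c T) :
    (T * T + c * T - R * D) * T = T * (T * T + c * T - R * D) := by
  have h1 : R * D * T = T * (R * D) := by
    rw [mul_assoc, hDT, ← mul_assoc T, hTR]; noncomm_ring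
  rw [sub_mul, mul_sub, h1, add_mul, mul_add, ← mul_assoc T c T, ← hc.eq, mul_assoc T T T]

theorem weyl_angular_mul_sq {T R D : A} (m : ℕ) (hDR : D * R = R * D + 4 * T + 2 * (m : A))
    (hTR : T * R = R * T + 2 * R) :
    (T * T + ((m : A) - 2) * T - R * D) * R = R * (T * T + ((m : A) - 2) * T - R * D) := by
  have hm := (Nat.cast_commute m R).eq
  have h1 : T * T * R = R * T * T + 4 * R * T + 4 * R := by
    rw [mul_assoc, hTR, mul_add, ← mul_assoc, hTR]
    have : T * (2 * R) = 2 * (T * R) := by noncomm_ring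
    rw [this, hTR]; noncomm_ring
  have h2 : ((m : A) - 2) * T * R = R * ((m : A) - 2) * T + 2 * (R * (m : A)) - 4 * R := by
    rw [mul_assoc, hTR, sub_mul, mul_add, ← mul_assoc, hm]
    have : (m : A) * (2 * R) = 2 * (m * R) := by
      rw [← mul_assoc, ← mul_assoc, (Nat.cast_commute m (2 : A)).eq]
    rw [this, hm]; noncomm_ring
  have h3 : R * D * R = R * R * D + 4 * R * T + 2 * (R * m) := by
    rw [mul_assoc, hDR]
    noncomm_ring
  rw [sub_mul, add_mul, h1, h2, h3]
  noncomm_ring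

end Weyl

/-! ### Test functions supported away from the origin -/

/-- The partial derivative in the `i`-th coordinate direction. -/
noncomputable def partialDeriv {n : ℕ} (i : Fin n) (f : EuclideanSpace ℝ (Fin n) → ℝ)
    (x : EuclideanSpace ℝ (Fin n)) : ℝ :=
  fderiv ℝ f x (EuclideanSpace.single i 1)

/-- Smooth functions with compact support contained in the complement of the origin. -/
noncomputable def testSpace (n : ℕ) : Submodule ℝ (EuclideanSpace ℝ (Fin n) → ℝ) where
  carrier := {f | ContDiff ℝ (⊤ : ℕ∞) f ∧ HasCompactSupport f ∧ 0 ∉ tsupport f}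
  zero_mem' := ⟨contDiff_const, HasCompactSupport.zero, by simp [tsupport]⟩
  add_mem' := by
    rintro f g ⟨hf, hf', hf0⟩ ⟨hg, hg', hg0⟩
    refine ⟨hf.add hg, hf'.add hg', fun h => ?_⟩
    rcases tsupport_add f g h with h | h
    exacts [hf0 h, hg0 h]
  smul_mem' := by
    rintro c f ⟨hf, hf', hf0⟩
    refine ⟨contDiff_const.smul hf, hf'.smul_left (f := fun _ => c), fun h => hf0 ?_⟩
    exact tsupport_smul_subset_right (fun _ => c) f h

namespace testSpace

variable {n : ℕ}

instance : CoeFun (testSpace n) fun _ => EuclideanSpace ℝ (Fin n) → ℝ := ⟨Subtype.val⟩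

theorem contDiff (f : testSpace n) : ContDiff ℝ (⊤ : ℕ∞) (f : EuclideanSpace ℝ (Fin n) → ℝ) :=
  f.2.1

theorem differentiable (f : testSpace n) :
    Differentiable ℝ (f : EuclideanSpace ℝ (Fin n) → ℝ) :=
  (contDiff f).differentiable (by simp)

theorem hasCompactSupport (f : testSpace n) :
    HasCompactSupport (f : EuclideanSpace ℝ (Fin n) → ℝ) := f.2.2.1

theorem zero_notMem (f : testSpace n) :
    0 ∉ tsupport (f : EuclideanSpace ℝ (Fin n) → ℝ) := f.2.2.2

theorem apply_zero (f : testSpace n) : f 0 = 0 :=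
  image_eq_zero_of_notMem_tsupport (zero_notMem f)

theorem integrable (f : testSpace n) : Integrable (f : EuclideanSpace ℝ (Fin n) → ℝ) :=
  (contDiff f).continuous.integrable_of_hasCompactSupport (hasCompactSupport f)

/-- Partial differentiation on the space of test functions. -/
noncomputable def deriv (i : Fin n) : Module.End ℝ (testSpace n) where
  toFun f := ⟨partialDeriv i f, by
    have hsub : tsupport (partialDeriv i (f : EuclideanSpace ℝ (Fin n) → ℝ))
        ⊆ tsupport (f : EuclideanSpace ℝ (Fin n) → ℝ) :=
      tsupport_fderiv_apply_subset ℝ (EuclideanSpace.single i 1)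
    refine ⟨?_, (hasCompactSupport f).of_isClosed_subset (isClosed_tsupport _) hsub,
      fun h => (zero_notMem f) (hsub h)⟩
    exact ((contDiff f).fderiv_right (m := (⊤ : ℕ∞)) (by simp)).clm_apply contDiff_const⟩
  map_add' f g := by
    ext x
    simp [partialDeriv, fderiv_add ((differentiable f) x) ((differentiable g) x)]
  map_smul' c f := by
    ext x
    simp [partialDeriv, fderiv_const_smul ((differentiable f) x) c]

@[simp] theorem coe_deriv (i : Fin n) (f : testSpace n) :
    (deriv i f : EuclideanSpace ℝ (Fin n) → ℝ) = partialDeriv i f := rfl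

/-- Multiplication by a function that is smooth away from the origin. -/
noncomputable def mul (g : EuclideanSpace ℝ (Fin n) → ℝ)
    (hg : ContDiffOn ℝ (⊤ : ℕ∞) g {0}ᶜ) : Module.End ℝ (testSpace n) where
  toFun f := ⟨fun x => g x * f x, by
    have hsub : tsupport (fun x => g x * f x) ⊆ tsupport (f : EuclideanSpace ℝ (Fin n) → ℝ) :=
      tsupport_mul_subset_right
    refine ⟨?_, (hasCompactSupport f).of_isClosed_subset (isClosed_tsupport _) hsub,
      fun h => (zero_notMem f) (hsub h)⟩
    rw [contDiff_iff_contDiffAt]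
    intro x
    by_cases hx : x = 0
    · have : (fun x => g x * f x) =ᶠ[nhds x] fun _ => 0 := by
        have := notMem_tsupport_iff_eventuallyEq.1 (zero_notMem f)
        rw [hx]
        filter_upwards [this] with y hy
        simp [hy]
      exact contDiffAt_const.congr_of_eventuallyEq this
    · exact (hg.contDiffAt (isOpen_compl_singleton.mem_nhds hx)).mul (contDiff f).contDiffAt⟩
  map_add' f h := by ext x; simp [mul_add]
  map_smul' c f := by ext x; simp [mul_left_comm]

/-- Multiplication by the `i`-th coordinate. -/
noncomputable def coord (i : Fin n) : Module.End ℝ (testSpace n) :=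
  mul (fun x => x i) (by fun_prop)

theorem contDiffOn_norm_rpow (s : ℝ) :
    ContDiffOn ℝ (⊤ : ℕ∞) (fun x : EuclideanSpace ℝ (Fin n) => ‖x‖ ^ s) {0}ᶜ :=
  (contDiffOn_id.norm ℝ fun _ hx => hx).rpow_const_of_ne fun _ hx => norm_ne_zero_iff.2 hx

/-- Multiplication by the power `|x|^s`. -/
noncomputable def normPow (s : ℝ) : Module.End ℝ (testSpace n) :=
  mul (fun x => ‖x‖ ^ s) (contDiffOn_norm_rpow s)

@[simp] theorem coe_coord (i : Fin n) (f : testSpace n) (x : EuclideanSpace ℝ (Fin n)) :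
    (coord i f) x = x i * f x := rfl

@[simp] theorem coe_normPow (s : ℝ) (f : testSpace n) (x : EuclideanSpace ℝ (Fin n)) :
    (normPow s f) x = ‖x‖ ^ s * f x := rfl

/-- The product of two test functions. -/
noncomputable def prod (f g : testSpace n) : testSpace n :=
  mul f (contDiff f).contDiffOn g

@[simp] theorem coe_prod (f g : testSpace n) (x : EuclideanSpace ℝ (Fin n)) :
    (prod f g) x = f x * g x := rfl

theorem prod_comm (f g : testSpace n) : prod f g = prod g f := by
  ext x; simp [mul_comm]

theorem ext_of_ne_zero {f g : testSpace n}
    (h : ∀ x ≠ 0, f x = g x) : f = g := by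
  ext x
  by_cases hx : x = 0
  · rw [hx, apply_zero, apply_zero]
  · exact h x hx

theorem partialDeriv_mul (i : Fin n) {g f : EuclideanSpace ℝ (Fin n) → ℝ}
    {x : EuclideanSpace ℝ (Fin n)} (hg : DifferentiableAt ℝ g x) (hf : DifferentiableAt ℝ f x) :
    partialDeriv i (fun y => g y * f y) x
      = g x * partialDeriv i f x + partialDeriv i g x * f x := by
  simp only [partialDeriv]
  rw [fderiv_fun_mul hg hf]
  simp [mul_comm]

theorem deriv_prod (i : Fin n) (f g : testSpace n) :
    deriv i (prod f g) = prod f (deriv i g) + prod (deriv i f) g := by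
  ext x
  exact partialDeriv_mul i ((differentiable f) x) ((differentiable g) x)

theorem deriv_mul_deriv (i j : Fin n) : deriv i * deriv j = deriv j * deriv (n := n) i := by
  refine LinearMap.ext fun f => ?_
  ext x
  have h : ∀ i j : Fin n, partialDeriv i (partialDeriv j (f : EuclideanSpace ℝ (Fin n) → ℝ)) x
      = fderiv ℝ (fderiv ℝ f) x (EuclideanSpace.single i 1) (EuclideanSpace.single j 1) := by
    intro i j
    have hd : DifferentiableAt ℝ (fderiv ℝ (f : EuclideanSpace ℝ (Fin n) → ℝ)) x :=
      ((contDiff f).fderiv_right (m := 1) (by norm_cast)).differentiable (by simp) x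
    change fderiv ℝ (fun y => fderiv ℝ f y
      (EuclideanSpace.single j 1)) x _ = _
    rw [fderiv_clm_apply hd (by fun_prop)]
    simp
  change partialDeriv i (partialDeriv j f) x = partialDeriv j (partialDeriv i f) x
  rw [h, h]
  exact ((contDiff f).contDiffAt.isSymmSndFDerivAt
    (by simpa using WithTop.coe_le_coe.2 (le_top (a := (2 : ℕ∞))))).eq _ _

theorem partialDeriv_coord (i j : Fin n) (x : EuclideanSpace ℝ (Fin n)) :
    partialDeriv i (fun y => y j) x = if i = j then 1 else 0 := by
  have : (fun y : EuclideanSpace ℝ (Fin n) => y j) = EuclideanSpace.proj (𝕜 := ℝ) j := rfl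
  simp only [partialDeriv, this, ContinuousLinearMap.fderiv]
  simp [eq_comm]

theorem deriv_mul_coord (i j : Fin n) :
    deriv i * coord j
      = coord j * deriv i + if i = j then (1 : Module.End ℝ (testSpace n)) else 0 := by
  refine LinearMap.ext fun f => ?_
  ext x
  have := partialDeriv_mul i (g := fun y => y j) (x := x) (by fun_prop) ((differentiable f) x)
  rw [partialDeriv_coord] at this
  split_ifs with h
  · refine this.trans ?_
    simp [h]
  · refine this.trans ?_
    simp [h]

theorem coord_mul_coord (i j : Fin n) : coord i * coord j = coord j * coord (n := n) i := by
  refine LinearMap.ext fun f => ?_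
  ext x
  simp [mul_left_comm]

/-- The Euler operator `x · ∇`. -/
noncomputable def euler : Module.End ℝ (testSpace n) := ∑ i, coord i * deriv i

/-- The Laplacian on test functions. -/
noncomputable def laplacian : Module.End ℝ (testSpace n) := ∑ i, deriv i * deriv i

/-- Multiplication by `|x|²`. -/
noncomputable def normSq : Module.End ℝ (testSpace n) := ∑ i, coord i * coord i

/-- The angular part of the Laplacian, `(x · ∇)² + (n - 2) x · ∇ - |x|² Δ`. -/
noncomputable def angular : Module.End ℝ (testSpace n) :=
  euler * euler + ((n : Module.End ℝ (testSpace n)) - 2) * euler - normSq * laplacian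

theorem coe_euler (f : testSpace n) (x : EuclideanSpace ℝ (Fin n)) :
    (euler f) x = ∑ i, x i * partialDeriv i f x := by
  simp [euler, LinearMap.sum_apply]

theorem coe_normSq (f : testSpace n) (x : EuclideanSpace ℝ (Fin n)) :
    (normSq f) x = ‖x‖ ^ 2 * f x := by
  rw [EuclideanSpace.norm_sq_eq]
  simp [normSq, LinearMap.sum_apply, Finset.sum_mul, ← mul_assoc, sq]

theorem angular_mul_euler : angular * euler = euler * angular (n := n) := by
  refine weyl_angular_mul_euler
    (weyl_lap_mul_euler (A := Module.End ℝ (testSpace n)) deriv_mul_deriv deriv_mul_coord)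
    (weyl_euler_mul_sq (A := Module.End ℝ (testSpace n)) coord_mul_coord deriv_mul_coord) ?_
  have h1 : Commute (n : Module.End ℝ (testSpace n)) euler := Nat.cast_commute n _
  have h2 : Commute (2 : Module.End ℝ (testSpace n)) euler := Commute.ofNat_left 2 _
  exact Commute.sub_left (R := Module.End ℝ (testSpace n)) h1 h2

theorem angular_apply (f : testSpace n) :
    angular f = euler (euler f) + ((n : ℝ) - 2) • euler f - normSq (laplacian f) := by
  have h : ((n : Module.End ℝ (testSpace n)) - 2) (euler f) = ((n : ℝ) - 2) • euler f := by
    ext x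
    simp [Module.End.natCast_apply, Module.End.ofNat_apply]
    ring
  simp only [angular, LinearMap.sub_apply, LinearMap.add_apply, Module.End.mul_apply, h]

theorem euler_prod (f g : testSpace n) :
    euler (prod f g) = prod f (euler g) + prod (euler f) g := by
  ext x
  simp only [coe_euler, Submodule.coe_add, Pi.add_apply, coe_prod, Finset.mul_sum,
    Finset.sum_mul, ← Finset.sum_add_distrib]
  refine Finset.sum_congr rfl fun i _ => ?_
  have := congrArg (fun h : testSpace n => h x) (deriv_prod i f g)
  simp only [coe_deriv, Submodule.coe_add, Pi.add_apply, coe_prod] at this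
  rw [this]; ring

theorem partialDeriv_radial (i : Fin n) {g : ℝ → ℝ} {g' : ℝ} {x : EuclideanSpace ℝ (Fin n)}
    (hg : HasDerivAt g g' (‖x‖ ^ 2)) :
    partialDeriv i (fun y => g (‖y‖ ^ 2)) x = 2 * g' * x i := by
  have h := hg.comp_hasFDerivAt x (hasStrictFDerivAt_norm_sq x).hasFDerivAt
  have h' : fderiv ℝ (fun y : EuclideanSpace ℝ (Fin n) => g (‖y‖ ^ 2)) x = _ := h.fderiv
  rw [partialDeriv, h']
  simp [EuclideanSpace.inner_single_right]
  ring

theorem partialDeriv_norm_rpow (i : Fin n) (s : ℝ) {x : EuclideanSpace ℝ (Fin n)} (hx : x ≠ 0) :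
    partialDeriv i (fun y => ‖y‖ ^ s) x = s * ‖x‖ ^ (s - 2) * x i := by
  have hx' : 0 < ‖x‖ := norm_pos_iff.2 hx
  have e : ∀ (t : ℝ) (y : EuclideanSpace ℝ (Fin n)), (‖y‖ ^ 2) ^ (t / 2) = ‖y‖ ^ t := by
    intro t y
    rw [← Real.rpow_natCast, ← Real.rpow_mul (norm_nonneg _)]
    congr 1; push_cast; ring
  have h := partialDeriv_radial i (x := x)
    (Real.hasDerivAt_rpow_const (p := s / 2) (Or.inl (by positivity : ‖x‖ ^ 2 ≠ 0)))
  have e2 : s / 2 - 1 = (s - 2) / 2 := by ring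
  simp only [e, e2] at h
  rw [h]; ring

theorem deriv_normPow (i : Fin n) (s : ℝ) (f : testSpace n) :
    deriv i (normPow s f) = normPow s (deriv i f) + s • normPow (s - 2) (coord i f) := by
  refine ext_of_ne_zero fun x hx => ?_
  have := partialDeriv_mul i (g := fun y => ‖y‖ ^ s) (x := x)
    (((contDiffOn_norm_rpow s).contDiffAt
      (isOpen_compl_singleton.mem_nhds hx)).differentiableAt (by simp)) ((differentiable f) x)
  rw [partialDeriv_norm_rpow i s hx] at this
  refine this.trans ?_
  simp; ring

end testSpace

namespace testSpace

variable {n : ℕ}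

/-- Integration of test functions. -/
noncomputable def integral : testSpace n →ₗ[ℝ] ℝ where
  toFun f := ∫ x, f x
  map_add' f g := integral_add (integrable f) (integrable g)
  map_smul' c f := integral_const_mul c f

theorem integral_deriv (i : Fin n) (f : testSpace n) : integral (deriv i f) = 0 := by
  have h := integral_mul_fderiv_eq_neg_fderiv_mul_of_integrable (𝕜 := ℝ) (μ := volume)
    (f := fun _ : EuclideanSpace ℝ (Fin n) => (1 : ℝ)) (g := f)
    (v := EuclideanSpace.single i 1) (by simp)
    (by simp only [one_mul]; exact integrable (deriv i f))
    (by simpa using integrable f) (by fun_prop) (fun x _ => differentiable f x)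
  simp only [one_mul, fderiv_fun_const, Pi.zero_apply, zero_apply, zero_mul,
    MeasureTheory.integral_zero, neg_zero] at h
  exact h

theorem integral_euler (f : testSpace n) : integral (euler f) = -(n : ℝ) * integral f := by
  have h : ∀ i : Fin n, integral (coord i (deriv i f)) + integral f = 0 := by
    intro i
    have h1 := congrArg (fun A : Module.End ℝ (testSpace n) => integral (A f))
      (deriv_mul_coord (n := n) i i)
    simpa [integral_deriv] using h1.symm
  have h2 := Finset.sum_congr rfl fun i (_ : i ∈ Finset.univ) => h i
  simp only [Finset.sum_add_distrib, Finset.sum_const, Finset.card_univ, Fintype.card_fin,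
    nsmul_eq_mul, mul_zero] at h2
  have h3 : integral (euler f) = ∑ i, integral (coord i (deriv i f)) := by
    simp [euler, LinearMap.sum_apply]
  linarith

theorem euler_normPow (s : ℝ) (f : testSpace n) :
    euler (normPow s f) = normPow s (euler f) + s • normPow s f := by
  refine ext_of_ne_zero fun x hx => ?_
  have h := fun i => congrArg (fun h : testSpace n => h x) (deriv_normPow i s f)
  simp only [coe_deriv, Submodule.coe_add, Pi.add_apply, coe_normPow, Submodule.coe_smul,
    Pi.smul_apply, smul_eq_mul, coe_coord] at h
  simp only [coe_euler, h, Submodule.coe_add, Pi.add_apply, coe_normPow, Submodule.coe_smul,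
    Pi.smul_apply, smul_eq_mul]
  have h2 : ‖x‖ ^ s = ‖x‖ ^ (s - 2) * ∑ i, x i ^ 2 := by
    rw [← EuclideanSpace.real_norm_sq_eq, ← Real.rpow_natCast,
      ← Real.rpow_add (norm_pos_iff.2 hx)]
    congr 1; push_cast; ring
  conv_rhs => rw [h2]
  simp only [Finset.mul_sum, Finset.sum_mul, mul_add, Finset.sum_add_distrib]
  rw [h2]
  simp only [Finset.mul_sum, Finset.sum_mul]
  congr 1
  · exact Finset.sum_congr rfl fun i _ => Finset.sum_congr rfl fun j _ => by ring
  · exact Finset.sum_congr rfl fun i _ => by ring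

/-- The bilinear form `∫ |x|^s f g`. -/
noncomputable def form (s : ℝ) : LinearMap.BilinForm ℝ (testSpace n) :=
  LinearMap.mk₂ ℝ (fun f g => integral (normPow s (prod f g)))
    (fun f f' g => by
      rw [← map_add, ← map_add]; congr 2; ext x; simp [add_mul])
    (fun c f g => by
      rw [← map_smul, ← map_smul]; congr 2; ext x; simp [mul_assoc])
    (fun f g g' => by
      rw [← map_add, ← map_add]; congr 2; ext x; simp [mul_add])
    (fun c f g => by
      rw [← map_smul, ← map_smul]; congr 2; ext x; simp [mul_left_comm])

theorem form_apply (s : ℝ) (f g : testSpace n) :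
    form s f g = integral (normPow s (prod f g)) := rfl

theorem form_eq_integral (s : ℝ) (f g : testSpace n) :
    form s f g = ∫ x, ‖x‖ ^ s * (f x * g x) := rfl

theorem form_comm (s : ℝ) (f g : testSpace n) : form s f g = form s g f := by
  rw [form_apply, form_apply, prod_comm]

theorem form_self_nonneg (s : ℝ) (f : testSpace n) : 0 ≤ form s f f := by
  rw [form_eq_integral]
  exact integral_nonneg fun x => mul_nonneg (Real.rpow_nonneg (norm_nonneg x) s)
    (mul_self_nonneg _)

theorem form_euler (s : ℝ) (f g : testSpace n) :
    form s (euler f) g = -form s f (euler g) - (n + s) * form s f g := by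
  have h := integral_euler (normPow s (prod f g))
  rw [euler_normPow, euler_prod] at h
  simp only [map_add, map_smul, smul_eq_mul] at h
  simp only [form_apply]
  linarith

theorem sum_form_deriv (s : ℝ) (f g : testSpace n) :
    ∑ i, form s (deriv i f) (deriv i g)
      = -form (s - 2) f (normSq (laplacian g)) - s * form (s - 2) f (euler g) := by
  have h : ∀ i, form s (deriv i f) (deriv i g)
      = -form s f (deriv i (deriv i g)) - s * form (s - 2) f (coord i (deriv i g)) := by
    intro i
    have h := integral_deriv i (normPow s (prod f (deriv i g)))
    rw [deriv_normPow, deriv_prod] at h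
    simp only [map_add, map_smul, smul_eq_mul] at h
    have e : coord i (prod f (deriv i g)) = prod f (coord i (deriv i g)) := by
      ext x; simp [mul_left_comm]
    rw [e] at h
    simp only [form_apply]
    linarith
  have h2 : form (s - 2) f (normSq (laplacian g)) = form s f (laplacian g) := by
    rw [form_apply, form_apply]
    congr 1
    refine ext_of_ne_zero fun x hx => ?_
    have : ‖x‖ ^ s = ‖x‖ ^ (s - 2) * ‖x‖ ^ 2 := by
      rw [← Real.rpow_natCast, ← Real.rpow_add (norm_pos_iff.2 hx)]
      congr 1; push_cast; ring
    simp only [coe_normPow, coe_prod, coe_normSq, this]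
    ring
  rw [h2, Finset.sum_congr rfl fun i _ => h i, Finset.sum_sub_distrib, Finset.sum_neg_distrib,
    ← Finset.mul_sum, laplacian, euler]
  simp [LinearMap.sum_apply]

/-- The Euler operator shifted so as to be skew-symmetric for `form (α - 4)`. -/
noncomputable def skewEuler (α : ℝ) : Module.End ℝ (testSpace n) :=
  euler - ((4 - n - α) / 2) • 1

theorem skewEuler_apply (α : ℝ) (f : testSpace n) :
    skewEuler α f = euler f - ((4 - n - α) / 2) • f := by
  simp [skewEuler]

theorem form_skewEuler (α : ℝ) (f g : testSpace n) :
    form (α - 4) (skewEuler α f) g = -form (α - 4) f (skewEuler α g) := by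
  simp only [skewEuler_apply, map_sub, map_smul, LinearMap.sub_apply, LinearMap.smul_apply,
    form_euler, smul_eq_mul]
  ring

theorem angular_skewEuler (α : ℝ) (f : testSpace n) :
    angular (skewEuler α f) = skewEuler α (angular f) := by
  have h := congrArg (fun A : Module.End ℝ (testSpace n) => A f) (angular_mul_euler (n := n))
  simp only [Module.End.mul_apply] at h
  simp only [skewEuler_apply, map_sub, map_smul, h]

theorem normSq_laplacian (α : ℝ) (f : testSpace n) :
    normSq (laplacian f) = skewEuler α (skewEuler α f) + (2 - α) • skewEuler α f
      - (((n : ℝ) - 4 + α) * (n - α) / 4) • f - angular f := by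
  rw [angular_apply]
  simp only [skewEuler_apply, map_sub, map_smul]
  module

theorem sum_form_deriv_eq_angular (α : ℝ) (f g : testSpace n) :
    ∑ i, form (α - 2) (deriv i f) (deriv i g)
      = form (α - 4) f (angular g) + form (α - 4) (skewEuler α f) (skewEuler α g)
        + (((n : ℝ) - 4 + α) / 2) ^ 2 * form (α - 4) f g := by
  have e : α - 2 - 2 = α - 4 := by ring
  have e2 : euler g = skewEuler α g + ((4 - n - α) / 2) • g := by rw [skewEuler_apply]; abel
  rw [sum_form_deriv, e, normSq_laplacian α, form_skewEuler, e2]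
  simp only [map_sub, map_add, map_smul, smul_eq_mul]
  ring

theorem form_angular_comm (α : ℝ) (f g : testSpace n) :
    form (α - 4) f (angular g) = form (α - 4) (angular f) g := by
  have h1 := sum_form_deriv_eq_angular α f g
  have h2 := sum_form_deriv_eq_angular α g f
  rw [Finset.sum_congr rfl fun i _ => form_comm (α - 2) (deriv i f) (deriv i g), h2,
    form_comm _ g f, form_comm _ (skewEuler α g), form_comm _ g (angular f)] at h1
  linarith

end testSpace

/-! ### Spectral decomposition of the energy -/

section Spectral

variable {V : Type*} [AddCommGroup V] [Module ℝ V] {B : LinearMap.BilinForm ℝ V}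
  {S L : Module.End ℝ V}

theorem form_eigen_eq_zero (hL : ∀ f g, B f (L g) = B (L f) g) {f g : V} {μ ν : ℝ}
    (hf : L f = μ • f) (hg : L g = ν • g) (hne : μ ≠ ν) : B f g = 0 := by
  have h := hL f g
  rw [hf, hg] at h
  simp only [map_smul, LinearMap.smul_apply, smul_eq_mul] at h
  have : (ν - μ) * B f g = 0 := by linarith
  exact (mul_eq_zero.1 this).resolve_left (sub_ne_zero.2 hne.symm)

theorem form_sum_eq_sum_form {ι : Type*} {s : Finset ι} {f g : ι → V} {μ : ι → ℝ}
    (hL : ∀ f g, B f (L g) = B (L f) g) (hμ : Function.Injective μ)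
    (hf : ∀ i ∈ s, L (f i) = μ i • f i) (hg : ∀ i ∈ s, L (g i) = μ i • g i) :
    B (∑ i ∈ s, f i) (∑ i ∈ s, g i) = ∑ i ∈ s, B (f i) (g i) := by
  simp only [map_sum, LinearMap.sum_apply]
  refine Finset.sum_congr rfl fun i hi => ?_
  refine (Finset.sum_eq_single_of_mem i hi fun j hj hji => ?_)
  exact form_eigen_eq_zero hL (hf j hj) (hg i hi) (hμ.ne hji)

theorem form_skew_sq_eq (hB : ∀ f g, B f g = B g f) (hS : ∀ f g, B (S f) g = -B f (S g))
    (f : V) (b c : ℝ) :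
    B (S (S f) + b • S f - c • f) (S (S f) + b • S f - c • f)
      = B (S (S f)) (S (S f)) + (b ^ 2 + 2 * c) * B (S f) (S f) + c ^ 2 * B f f := by
  have h0 : ∀ g, B (S g) g = 0 := fun g => by
    have h1 := hS g g
    rw [hB g (S g)] at h1
    linarith
  have h1 := hS (S f) f
  have h2 := h0 f
  have h3 := h0 (S f)
  have h2' := hB f (S f)
  have h3' := hB (S f) (S (S f))
  have h1' := hB f (S (S f))
  simp only [map_add, map_sub, map_smul, LinearMap.add_apply, LinearMap.sub_apply,
    LinearMap.smul_apply, smul_eq_mul]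
  rw [h3', h2', h1', h3, h2, h1]
  ring

theorem energy_le_of_sum_eigen {ι : Type*} {s : Finset ι} {f : ι → V} {μ : ι → ℝ}
    (hB : ∀ f g, B f g = B g f) (hB0 : ∀ f, 0 ≤ B f f)
    (hS : ∀ f g, B (S f) g = -B f (S g)) (hL : ∀ f g, B f (L g) = B (L f) g)
    (hLS : ∀ f, L (S f) = S (L f)) (hμ : Function.Injective μ)
    (hf : ∀ i ∈ s, L (f i) = μ i • f i) (b γ h C : ℝ)
    (hC1 : ∀ i ∈ s, C ≤ b ^ 2 + 2 * (γ + μ i))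
    (hC2 : ∀ i ∈ s, C * (h + μ i) ≤ (γ + μ i) ^ 2) :
    C * (B (∑ i ∈ s, f i) (L (∑ i ∈ s, f i)) + B (S (∑ i ∈ s, f i)) (S (∑ i ∈ s, f i))
        + h * B (∑ i ∈ s, f i) (∑ i ∈ s, f i))
      ≤ B (S (S (∑ i ∈ s, f i)) + b • S (∑ i ∈ s, f i) - γ • (∑ i ∈ s, f i) - L (∑ i ∈ s, f i))
          (S (S (∑ i ∈ s, f i)) + b • S (∑ i ∈ s, f i) - γ • (∑ i ∈ s, f i)
            - L (∑ i ∈ s, f i)) := by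
  have hLf : L (∑ i ∈ s, f i) = ∑ i ∈ s, μ i • f i := by
    rw [map_sum]; exact Finset.sum_congr rfl hf
  have hSf : ∀ i ∈ s, L (S (f i)) = μ i • S (f i) := fun i hi => by
    rw [hLS, hf i hi, map_smul]
  have hA : S (S (∑ i ∈ s, f i)) + b • S (∑ i ∈ s, f i) - γ • (∑ i ∈ s, f i)
      - L (∑ i ∈ s, f i) = ∑ i ∈ s, (S (S (f i)) + b • S (f i) - (γ + μ i) • f i) := by
    rw [hLf]
    simp only [map_sum, Finset.smul_sum, Finset.sum_sub_distrib, Finset.sum_add_distrib, add_smul]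
    abel
  have hAe : ∀ i ∈ s, L (S (S (f i)) + b • S (f i) - (γ + μ i) • f i)
      = μ i • (S (S (f i)) + b • S (f i) - (γ + μ i) • f i) := fun i hi => by
    simp only [map_add, map_sub, map_smul, hLS, hf i hi, smul_add, smul_sub]
    module
  rw [hA, hLf, form_sum_eq_sum_form hL hμ hAe hAe,
    form_sum_eq_sum_form (g := fun i => μ i • f i) hL hμ hf
      (fun i hi => by rw [map_smul, hf i hi]),
    form_sum_eq_sum_form hL hμ hf hf, map_sum, form_sum_eq_sum_form hL hμ hSf hSf,
    Finset.mul_sum, ← Finset.sum_add_distrib, ← Finset.sum_add_distrib, Finset.mul_sum]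
  refine Finset.sum_le_sum fun i hi => ?_
  rw [form_skew_sq_eq hB hS, map_smul, smul_eq_mul]
  nlinarith [hB0 (S (S (f i))), mul_le_mul_of_nonneg_right (hC1 i hi) (hB0 (S (f i))),
    mul_le_mul_of_nonneg_right (hC2 i hi) (hB0 (f i))]

end Spectral

namespace testSpace

variable {n : ℕ}

theorem form_normSq (α : ℝ) (f : testSpace n) :
    form (α - 4) (normSq f) (normSq f) = form α f f := by
  rw [form_apply, form_apply]
  congr 1
  refine ext_of_ne_zero fun x hx => ?_
  have : ‖x‖ ^ α = ‖x‖ ^ (α - 4) * ‖x‖ ^ 4 := by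
    rw [← Real.rpow_natCast, ← Real.rpow_add (norm_pos_iff.2 hx)]
    congr 1; push_cast; ring
  simp only [coe_normPow, coe_prod, coe_normSq, this]
  ring

theorem rellich_of_sum_eigen (α C : ℝ) {ι : Type*} {s : Finset ι} {f : ι → testSpace n}
    {μ : ι → ℝ} (hμ : Function.Injective μ) (hf : ∀ i ∈ s, angular (f i) = μ i • f i)
    (hC1 : ∀ i ∈ s, C ≤ (2 - α) ^ 2 + 2 * (((n : ℝ) - 4 + α) * (n - α) / 4 + μ i))
    (hC2 : ∀ i ∈ s, C * ((((n : ℝ) - 4 + α) / 2) ^ 2 + μ i)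
      ≤ (((n : ℝ) - 4 + α) * (n - α) / 4 + μ i) ^ 2) :
    C * ∑ j, form (α - 2) (deriv j (∑ i ∈ s, f i)) (deriv j (∑ i ∈ s, f i))
      ≤ form α (laplacian (∑ i ∈ s, f i)) (laplacian (∑ i ∈ s, f i)) := by
  have h := energy_le_of_sum_eigen (form_comm (n := n) (α - 4)) (form_self_nonneg (α - 4))
    (form_skewEuler α) (form_angular_comm α) (angular_skewEuler α) hμ hf (2 - α)
    (((n : ℝ) - 4 + α) * (n - α) / 4) ((((n : ℝ) - 4 + α) / 2) ^ 2) C hC1 hC2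
  rwa [← normSq_laplacian, ← sum_form_deriv_eq_angular, form_normSq] at h

end testSpace

/-! ### Spherical decomposition of polynomials -/

namespace MvPolynomial

variable {n : ℕ}

/-- The Euler operator on polynomials. -/
noncomputable def polyEuler (n : ℕ) : Module.End ℝ (MvPolynomial (Fin n) ℝ) :=
  ∑ i, LinearMap.mulLeft ℝ (X i) * (pderiv i).toLinearMap

/-- The Laplacian on polynomials. -/
noncomputable def polyLaplacian (n : ℕ) : Module.End ℝ (MvPolynomial (Fin n) ℝ) :=
  ∑ i, (pderiv i).toLinearMap * (pderiv i).toLinearMap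

/-- Multiplication by the square of the radius on polynomials. -/
noncomputable def polyNormSq (n : ℕ) : Module.End ℝ (MvPolynomial (Fin n) ℝ) :=
  ∑ i, LinearMap.mulLeft ℝ (X i) * LinearMap.mulLeft ℝ (X i)

/-- The angular part of the Laplacian on polynomials. -/
noncomputable def polyAngular (n : ℕ) : Module.End ℝ (MvPolynomial (Fin n) ℝ) :=
  polyEuler n * polyEuler n + ((n : Module.End ℝ (MvPolynomial (Fin n) ℝ)) - 2) * polyEuler n
    - polyNormSq n * polyLaplacian n

theorem polyEuler_apply (p : MvPolynomial (Fin n) ℝ) :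
    polyEuler n p = ∑ i, X i * pderiv i p := by
  simp [polyEuler, LinearMap.sum_apply]

theorem polyLaplacian_apply (p : MvPolynomial (Fin n) ℝ) :
    polyLaplacian n p = ∑ i, pderiv i (pderiv i p) := by
  simp [polyLaplacian, LinearMap.sum_apply]

theorem polyNormSq_apply (p : MvPolynomial (Fin n) ℝ) :
    polyNormSq n p = (∑ i, X i * X i) * p := by
  simp [polyNormSq, LinearMap.sum_apply, Finset.sum_mul, mul_assoc]

theorem polyAngular_apply (p : MvPolynomial (Fin n) ℝ) :
    polyAngular n p = polyEuler n (polyEuler n p) + ((n : ℝ) - 2) • polyEuler n p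
      - polyNormSq n (polyLaplacian n p) := by
  have h : ((n : Module.End ℝ (MvPolynomial (Fin n) ℝ)) - 2) (polyEuler n p)
      = ((n : ℝ) - 2) • polyEuler n p := by
    rw [LinearMap.sub_apply, Module.End.natCast_apply, Module.End.ofNat_apply, sub_smul]
    congr 1
    · exact (Nat.cast_smul_eq_nsmul ℝ n _).symm
    · exact (ofNat_smul_eq_nsmul ℝ 2 _).symm
  simp only [polyAngular, LinearMap.sub_apply, LinearMap.add_apply, Module.End.mul_apply, h]

theorem polyAngular_polyNormSq (p : MvPolynomial (Fin n) ℝ) :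
    polyAngular n (polyNormSq n p) = polyNormSq n (polyAngular n p) := by
  have hdx : ∀ i j : Fin n, ((pderiv i).toLinearMap : Module.End ℝ (MvPolynomial (Fin n) ℝ))
      * LinearMap.mulLeft ℝ (X j) = LinearMap.mulLeft ℝ (X j) * (pderiv i).toLinearMap
        + if i = j then 1 else 0 := by
    intro i j
    refine LinearMap.ext fun p => ?_
    by_cases h : i = j
    · subst h; simp [Derivation.leibniz]
    · simp [Derivation.leibniz, h, pderiv_X_of_ne (Ne.symm h)]
  have hxx : ∀ i j : Fin n, (LinearMap.mulLeft ℝ (X i) : Module.End ℝ (MvPolynomial (Fin n) ℝ))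
      * LinearMap.mulLeft ℝ (X j) = LinearMap.mulLeft ℝ (X j) * LinearMap.mulLeft ℝ (X i) := by
    intro i j
    refine LinearMap.ext fun p => ?_
    simp [mul_left_comm]
  have h := weyl_angular_mul_sq n
    (by simpa using weyl_lap_mul_sq (A := Module.End ℝ (MvPolynomial (Fin n) ℝ)) hdx)
    (weyl_euler_mul_sq (A := Module.End ℝ (MvPolynomial (Fin n) ℝ)) hxx hdx)
  exact congrArg (fun A : Module.End ℝ (MvPolynomial (Fin n) ℝ) => A p) h

/-- The eigenvalues of the spherical Laplacian. -/
noncomputable def sphereEigenvalue (n k : ℕ) : ℝ := k * ((n : ℝ) - 2 + k)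

theorem sphereEigenvalue_strictMono (hn : 2 ≤ n) : StrictMono (sphereEigenvalue n) := by
  have hn' : (2 : ℝ) ≤ n := by exact_mod_cast hn
  refine strictMono_nat_of_lt_succ fun k => ?_
  simp only [sphereEigenvalue]
  push_cast
  have : (0 : ℝ) ≤ k := Nat.cast_nonneg k
  nlinarith

theorem polyEuler_of_isHomogeneous {p : MvPolynomial (Fin n) ℝ} {m : ℕ} (hp : p.IsHomogeneous m) :
    polyEuler n p = (m : ℝ) • p := by
  rw [polyEuler_apply, hp.sum_X_mul_pderiv, Nat.cast_smul_eq_nsmul]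

theorem polyAngular_of_isHomogeneous {p : MvPolynomial (Fin n) ℝ} {m : ℕ}
    (hp : p.IsHomogeneous m) :
    polyAngular n p = sphereEigenvalue n m • p - polyNormSq n (polyLaplacian n p) := by
  rw [polyAngular_apply, polyEuler_of_isHomogeneous hp, map_smul, polyEuler_of_isHomogeneous hp,
    sphereEigenvalue]
  module

open Module.End in
theorem mem_iSup_eigenspace_of_isHomogeneous (hn : 2 ≤ n) (m : ℕ) :
    ∀ p : MvPolynomial (Fin n) ℝ, p.IsHomogeneous m →
      p ∈ ⨆ k : Finset.range (m + 1), eigenspace (polyAngular n) (sphereEigenvalue n k) := by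
  induction m using Nat.strong_induction_on with
  | _ m ih =>
    intro p hp
    set W := ⨆ k : Finset.range (m + 1), eigenspace (polyAngular n) (sphereEigenvalue n k)
      with hW
    have hle : ∀ k ≤ m, eigenspace (polyAngular n) (sphereEigenvalue n k) ≤ W := fun k hk =>
      le_iSup (fun k : Finset.range (m + 1) =>
        eigenspace (polyAngular n) (sphereEigenvalue n k))
        ⟨k, Finset.mem_range.2 (Nat.lt_succ_of_le hk)⟩
    have hL := polyAngular_of_isHomogeneous hp
    obtain ⟨r, hr, hr'⟩ : ∃ r ∈ W, polyAngular n r - sphereEigenvalue n m • r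
        = polyNormSq n (polyLaplacian n p) := by
      rcases lt_or_ge m 2 with hm | hm
      · have h0 : polyLaplacian n p = 0 := by
          rw [polyLaplacian_apply]
          refine Finset.sum_eq_zero fun i _ => ?_
          have h1 : (pderiv i p).IsHomogeneous 0 := by
            have := hp.pderiv (i := i)
            rwa [show m - 1 = 0 by omega] at this
          rw [totalDegree_eq_zero_iff_eq_C.1 ((totalDegree_zero_iff_isHomogeneous _).2 h1),
            pderiv_C]
        exact ⟨0, W.zero_mem, by simp [h0]⟩
      · have h1 : (polyLaplacian n p).IsHomogeneous (m - 2) := by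
          rw [polyLaplacian_apply]
          exact IsHomogeneous.sum _ _ _ fun i _ => by
            simpa [Nat.sub_sub] using (hp.pderiv (i := i)).pderiv (i := i)
        have h2 := ih (m - 2) (by omega) _ h1
        have h3 : (⨆ k : Finset.range (m - 2 + 1),
            eigenspace (polyAngular n) (sphereEigenvalue n k))
            ≤ (W.map (polyAngular n - sphereEigenvalue n m • 1)).comap (polyNormSq n) := by
          refine iSup_le fun k q hq => ?_
          have hk : (k : ℕ) < m := by have := Finset.mem_range.1 k.2; omega
          have hne : sphereEigenvalue n k - sphereEigenvalue n m ≠ 0 :=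
            sub_ne_zero.2 (sphereEigenvalue_strictMono hn hk).ne
          have hq' : polyAngular n (polyNormSq n q) = sphereEigenvalue n k • polyNormSq n q := by
            rw [polyAngular_polyNormSq, mem_eigenspace_iff.1 hq, map_smul]
          refine ⟨(sphereEigenvalue n k - sphereEigenvalue n m)⁻¹ • polyNormSq n q,
            W.smul_mem _ (hle k hk.le (mem_eigenspace_iff.2 hq')), ?_⟩
          simp only [LinearMap.sub_apply, LinearMap.smul_apply, Module.End.one_apply, map_smul, hq']
          rw [← sub_smul, smul_smul, inv_mul_cancel₀ hne, one_smul]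
        obtain ⟨r, hr, hr'⟩ := h3 h2
        exact ⟨r, hr, by simpa using hr'⟩
    have h4 : p + r ∈ W := hle m le_rfl <| mem_eigenspace_iff.2 <| by
      rw [map_add, hL, ← hr', smul_add]; abel
    simpa using W.sub_mem h4 hr

open Module.End in
theorem exists_eq_sum_eigen (hn : 2 ≤ n) (p : MvPolynomial (Fin n) ℝ) :
    ∃ (s : Finset ℕ) (q : ℕ → MvPolynomial (Fin n) ℝ),
      (∀ k, polyAngular n (q k) = sphereEigenvalue n k • q k) ∧ p = ∑ k ∈ s, q k := by
  have hp : p ∈ ⨆ k, eigenspace (polyAngular n) (sphereEigenvalue n k) := by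
    rw [← sum_homogeneousComponent p]
    refine Submodule.sum_mem _ fun m _ => ?_
    exact iSup_le (fun k : Finset.range (m + 1) => le_iSup (fun k : ℕ =>
      eigenspace (polyAngular n) (sphereEigenvalue n k)) k)
      (mem_iSup_eigenspace_of_isHomogeneous hn m _ (homogeneousComponent_isHomogeneous m p))
  classical
  obtain ⟨f, hf⟩ := (Submodule.mem_iSup_iff_exists_dfinsupp' _ _).1 hp
  exact ⟨f.support, fun k => f k, fun k => mem_eigenspace_iff.1 (f k).2, hf.symm⟩

end MvPolynomial

/-! ### Radial functions times polynomials -/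

theorem MvPolynomial.contDiff_eval {n : ℕ} (p : MvPolynomial (Fin n) ℝ) :
    ContDiff ℝ (⊤ : ℕ∞) fun x : EuclideanSpace ℝ (Fin n) => MvPolynomial.eval x.ofLp p := by
  induction p using MvPolynomial.induction_on with
  | C a => simpa using contDiff_const
  | add p q hp hq => simpa using hp.add hq
  | mul_X p i hp =>
    simp only [map_mul, MvPolynomial.eval_X]
    exact hp.mul (by fun_prop)

theorem MvPolynomial.partialDeriv_eval {n : ℕ} (i : Fin n) (p : MvPolynomial (Fin n) ℝ)
    (x : EuclideanSpace ℝ (Fin n)) :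
    partialDeriv i (fun y => MvPolynomial.eval y.ofLp p) x
      = MvPolynomial.eval x.ofLp (MvPolynomial.pderiv i p) := by
  induction p using MvPolynomial.induction_on with
  | C a => simp [partialDeriv]
  | add p q hp hq =>
    simp only [map_add, ← hp, ← hq, partialDeriv]
    rw [fderiv_fun_add ((p.contDiff_eval).differentiable (by simp) x)
      ((q.contDiff_eval).differentiable (by simp) x)]
    rfl
  | mul_X p j hp =>
    have h := testSpace.partialDeriv_mul i (x := x) (f := fun y => y j)
      ((p.contDiff_eval).differentiable (by simp) x) (by fun_prop)
    simp only [map_mul, MvPolynomial.eval_X]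
    rw [h, hp, testSpace.partialDeriv_coord]
    simp only [Derivation.leibniz, MvPolynomial.pderiv_X, smul_eq_mul, map_add, map_mul,
      MvPolynomial.eval_X, Pi.single_apply]
    by_cases hij : i = j
    · subst hij; simp; ring
    · simp [hij, Ne.symm hij]; ring

namespace testSpace

variable {n : ℕ}

open MvPolynomial

/-- Multiplication of a test function by a polynomial. -/
noncomputable def polyMul (p : MvPolynomial (Fin n) ℝ) : Module.End ℝ (testSpace n) :=
  mul (fun x => eval x.ofLp p) p.contDiff_eval.contDiffOn

@[simp] theorem coe_polyMul (p : MvPolynomial (Fin n) ℝ) (f : testSpace n)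
    (x : EuclideanSpace ℝ (Fin n)) : (polyMul p f) x = eval x.ofLp p * f x := rfl

theorem polyMul_sum {ι : Type*} (s : Finset ι) (p : ι → MvPolynomial (Fin n) ℝ)
    (f : testSpace n) : polyMul (∑ i ∈ s, p i) f = ∑ i ∈ s, polyMul (p i) f := by
  ext x; simp [Finset.sum_mul]

theorem polyMul_add (p q : MvPolynomial (Fin n) ℝ) (f : testSpace n) :
    polyMul (p + q) f = polyMul p f + polyMul q f := by
  ext x; simp [add_mul]

theorem polyMul_sub (p q : MvPolynomial (Fin n) ℝ) (f : testSpace n) :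
    polyMul (p - q) f = polyMul p f - polyMul q f := by
  ext x; simp [sub_mul]

theorem polyMul_smul (c : ℝ) (p : MvPolynomial (Fin n) ℝ) (f : testSpace n) :
    polyMul (c • p) f = c • polyMul p f := by
  ext x; simp [mul_assoc]

theorem polyMul_X_mul (i : Fin n) (p : MvPolynomial (Fin n) ℝ) (f : testSpace n) :
    polyMul (X i * p) f = coord i (polyMul p f) := by
  ext x; simp [mul_assoc]

theorem coord_polyMul (i : Fin n) (p : MvPolynomial (Fin n) ℝ) (f : testSpace n) :
    coord i (polyMul p f) = polyMul p (coord i f) := by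
  ext x; simp [mul_left_comm]

theorem deriv_polyMul (i : Fin n) (p : MvPolynomial (Fin n) ℝ) (f : testSpace n) :
    deriv i (polyMul p f) = polyMul p (deriv i f) + polyMul (pderiv i p) f := by
  ext x
  refine (partialDeriv_mul i (p.contDiff_eval.differentiable (by simp) x)
    (differentiable f x)).trans ?_
  rw [partialDeriv_eval]
  rfl

theorem euler_apply (f : testSpace n) : euler f = ∑ i, coord i (deriv i f) := by
  simp [euler, LinearMap.sum_apply]

theorem laplacian_apply (f : testSpace n) : laplacian f = ∑ i, deriv i (deriv i f) := by
  simp [laplacian, LinearMap.sum_apply]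

theorem normSq_apply (f : testSpace n) : normSq f = ∑ i, coord i (coord i f) := by
  simp [normSq, LinearMap.sum_apply]

theorem euler_polyMul (p : MvPolynomial (Fin n) ℝ) (f : testSpace n) :
    euler (polyMul p f) = polyMul p (euler f) + polyMul (polyEuler n p) f := by
  simp only [euler_apply, deriv_polyMul, map_add, polyEuler_apply, Finset.sum_add_distrib,
    polyMul_sum, map_sum, polyMul_X_mul, coord_polyMul]

theorem coord_coord (i j : Fin n) (f : testSpace n) :
    coord i (coord j f) = coord j (coord i f) := by
  ext x; simp [mul_left_comm]

theorem deriv_coord (i j : Fin n) (f : testSpace n) :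
    deriv i (coord j f) = coord j (deriv i f) + if i = j then f else 0 := by
  have := congrArg (fun A : Module.End ℝ (testSpace n) => A f) (deriv_mul_coord i j)
  simp only [Module.End.mul_apply, LinearMap.add_apply] at this
  rw [this]
  split_ifs <;> simp

theorem angular_eq_zero {f : testSpace n}
    (hf : ∀ i j, coord i (deriv j f) = coord j (deriv i f)) : angular f = 0 := by
  have h : ∀ i j, coord j (coord j (deriv i (deriv i f)))
      = coord j (deriv j f) + coord i (coord j (deriv i (deriv j f)))
        - if i = j then coord j (deriv i f) else 0 := by
    intro i j
    have h1 := deriv_coord i j (deriv i f)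
    rw [← hf i j, deriv_coord, if_pos rfl] at h1
    have h2 := congrArg (coord j) (eq_sub_of_add_eq h1.symm)
    rw [h2]
    simp only [map_sub, map_add, coord_coord j i]
    split_ifs <;> simp <;> abel
  have h1 : normSq (laplacian f) = ((n : ℝ) - 1) • euler f
      + ∑ i, ∑ j, coord i (coord j (deriv i (deriv j f))) := by
    simp only [normSq_apply, laplacian_apply, map_sum]
    have h0 : ∀ i, ∑ j, coord j (coord j (deriv i (deriv i f)))
        = euler f + ∑ j, coord i (coord j (deriv i (deriv j f))) - coord i (deriv i f) := by
      intro i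
      rw [Finset.sum_congr rfl fun j _ => h i j, Finset.sum_sub_distrib, Finset.sum_add_distrib,
        ← euler_apply, Finset.sum_ite_eq, if_pos (Finset.mem_univ i)]
    rw [Finset.sum_congr rfl fun i _ => h0 i, Finset.sum_sub_distrib, Finset.sum_add_distrib,
      ← euler_apply, Finset.sum_const, Finset.card_univ, Fintype.card_fin,
      ← Nat.cast_smul_eq_nsmul ℝ]
    module
  have h2 : euler (euler f) = euler f + ∑ i, ∑ j, coord i (coord j (deriv i (deriv j f))) := by
    have h0 : ∀ i, coord i (deriv i (euler f))
        = coord i (deriv i f) + ∑ j, coord i (coord j (deriv i (deriv j f))) := by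
      intro i
      rw [euler_apply f, map_sum, map_sum]
      simp only [deriv_coord, map_add, Finset.sum_add_distrib]
      rw [add_comm]
      congr 1
      rw [Finset.sum_eq_single i] <;> simp +contextual [eq_comm]
    rw [euler_apply (euler f), Finset.sum_congr rfl fun i _ => h0 i, Finset.sum_add_distrib,
      ← euler_apply]
  rw [angular_apply, h1, h2]
  module

theorem angular_polyMul (p : MvPolynomial (Fin n) ℝ) {f : testSpace n}
    (hf : ∀ i j, coord i (deriv j f) = coord j (deriv i f)) :
    angular (polyMul p f) = polyMul (polyAngular n p) f := by
  have h0 := angular_eq_zero hf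
  rw [angular_apply] at h0
  have h1 : laplacian (polyMul p f) = polyMul p (laplacian f)
      + (2 : ℝ) • (∑ i, polyMul (pderiv i p) (deriv i f)) + polyMul (polyLaplacian n p) f := by
    simp only [laplacian_apply, deriv_polyMul, map_add, Finset.sum_add_distrib, map_sum,
      polyLaplacian_apply, polyMul_sum]
    module
  have h2 : normSq (∑ i, polyMul (pderiv i p) (deriv i f))
      = polyMul (polyEuler n p) (euler f) := by
    simp only [normSq_apply, map_sum, polyEuler_apply, polyMul_sum, euler_apply]
    rw [Finset.sum_comm]
    refine Finset.sum_congr rfl fun i _ => Finset.sum_congr rfl fun j _ => ?_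
    rw [coord_polyMul, coord_polyMul, hf i j, polyMul_X_mul, coord_polyMul, coord_coord]
  have h3 : ∀ q g, normSq (polyMul q g) = polyMul (n := n) q (normSq g) := by
    intro q g
    simp only [normSq_apply, map_sum, coord_polyMul]
  have h4 : ∀ q g, polyMul (n := n) (polyNormSq n q) g = polyMul q (normSq g) := by
    intro q g
    simp only [polyNormSq_apply, Finset.sum_mul, mul_assoc, polyMul_sum, polyMul_X_mul,
      normSq_apply, map_sum, coord_polyMul]
  have h5 := congrArg (polyMul p) h0
  simp only [map_add, map_sub, map_smul, map_zero] at h5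
  rw [angular_apply, h1, polyAngular_apply]
  simp only [euler_polyMul, map_add, map_smul, polyMul_sub, polyMul_add, polyMul_smul, h2, h3, h4,
    smul_add]
  rw [← sub_eq_zero, ← h5]
  module

end testSpace

/-! ### The optimal constant -/

/-- The optimal constant in the weighted Hardy–Rellich inequality. -/
noncomputable def rellichConst (n : ℕ) (α : ℝ) : ℝ :=
  ⨅ k : ℕ, (((n : ℝ) - 4 + α) * (n - α) / 4 + MvPolynomial.sphereEigenvalue n k) ^ 2
    / ((((n : ℝ) - 4 + α) / 2) ^ 2 + MvPolynomial.sphereEigenvalue n k)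

section Constant

variable {n : ℕ} {α : ℝ}

theorem sphereEigenvalue_nonneg (hn : 2 ≤ n) (k : ℕ) : 0 ≤ MvPolynomial.sphereEigenvalue n k := by
  have h := (MvPolynomial.sphereEigenvalue_strictMono hn).monotone (Nat.zero_le k)
  simpa [MvPolynomial.sphereEigenvalue] using h

theorem hardy_add_sphereEigenvalue_pos (hn : 2 ≤ n) (hα : α ≠ 4 - n) (k : ℕ) :
    0 < (((n : ℝ) - 4 + α) / 2) ^ 2 + MvPolynomial.sphereEigenvalue n k := by
  have h : (n : ℝ) - 4 + α ≠ 0 := fun h => hα (by linarith)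
  have := sphereEigenvalue_nonneg hn k
  positivity

theorem rellichConst_le (hn : 2 ≤ n) (hα : α ≠ 4 - n) (k : ℕ) :
    rellichConst n α
      ≤ (((n : ℝ) - 4 + α) * (n - α) / 4 + MvPolynomial.sphereEigenvalue n k) ^ 2
        / ((((n : ℝ) - 4 + α) / 2) ^ 2 + MvPolynomial.sphereEigenvalue n k) :=
  ciInf_le ⟨0, by
    rintro _ ⟨j, rfl⟩
    exact div_nonneg (sq_nonneg _) (hardy_add_sphereEigenvalue_pos hn hα j).le⟩ k

theorem rellichConst_mul_le (hn : 2 ≤ n) (hα : α ≠ 4 - n) (k : ℕ) :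
    rellichConst n α * ((((n : ℝ) - 4 + α) / 2) ^ 2 + MvPolynomial.sphereEigenvalue n k)
      ≤ (((n : ℝ) - 4 + α) * (n - α) / 4 + MvPolynomial.sphereEigenvalue n k) ^ 2 :=
  (le_div_iff₀ (hardy_add_sphereEigenvalue_pos hn hα k)).1 (rellichConst_le hn hα k)

theorem rellichConst_le_add (hn : 2 ≤ n) (hα : α ≠ 4 - n) (k : ℕ) :
    rellichConst n α ≤ (2 - α) ^ 2
      + 2 * (((n : ℝ) - 4 + α) * (n - α) / 4 + MvPolynomial.sphereEigenvalue n k) := by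
  refine (rellichConst_le hn hα k).trans
    ((div_le_iff₀ (hardy_add_sphereEigenvalue_pos hn hα k)).2 ?_)
  have h0 := sphereEigenvalue_nonneg hn k
  set l := MvPolynomial.sphereEigenvalue n k
  have h1 : 0 ≤ l * (((n : ℝ) - 4 + α) / 2) ^ 2 := by positivity
  have h2 : 0 ≤ l * (2 - α) ^ 2 := by positivity
  nlinarith [sq_nonneg l, sq_nonneg ((((n : ℝ) - 4 + α) / 2) ^ 2)]

end Constant

namespace testSpace

variable {n : ℕ}

theorem coord_deriv_comm_of_radial {f : testSpace n} {g : ℝ → ℝ}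
    (hg : ∀ t, 0 < t → DifferentiableAt ℝ g t) (hf : ∀ x ≠ 0, f x = g (‖x‖ ^ 2)) (i j : Fin n) :
    coord i (deriv j f) = coord j (deriv i f) := by
  refine ext_of_ne_zero fun x hx => ?_
  have h : ∀ i, partialDeriv i f x = 2 * _root_.deriv g (‖x‖ ^ 2) * x i := fun i => by
    have he : (f : EuclideanSpace ℝ (Fin n) → ℝ) =ᶠ[nhds x] fun y => g (‖y‖ ^ 2) := by
      filter_upwards [isOpen_compl_singleton.mem_nhds hx] with y hy using hf y hy
    rw [partialDeriv, he.fderiv_eq]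
    exact partialDeriv_radial i (hg _ (by have := norm_pos_iff.2 hx; positivity)).hasDerivAt
  simp only [coe_coord, coe_deriv, h]
  ring

theorem rellich_polyMul (hn : 2 ≤ n) {α : ℝ} (hα : α ≠ 4 - n) (p : MvPolynomial (Fin n) ℝ)
    {f : testSpace n} (hf : ∀ i j, coord i (deriv j f) = coord j (deriv i f)) :
    rellichConst n α * ∑ j, form (α - 2) (deriv j (polyMul p f)) (deriv j (polyMul p f))
      ≤ form α (laplacian (polyMul p f)) (laplacian (polyMul p f)) := by
  obtain ⟨s, q, hq, rfl⟩ := MvPolynomial.exists_eq_sum_eigen hn p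
  rw [polyMul_sum]
  refine rellich_of_sum_eigen α _ (μ := MvPolynomial.sphereEigenvalue n)
    (MvPolynomial.sphereEigenvalue_strictMono hn).injective (fun k _ => ?_)
    (fun k _ => rellichConst_le_add hn hα k) (fun k _ => rellichConst_mul_le hn hα k)
  rw [angular_polyMul _ hf, hq, polyMul_smul]

/-- A radial cut-off function around a compact subset of the punctured space. -/
theorem exists_radial_cutoff {K : Set (EuclideanSpace ℝ (Fin n))} (hK : IsCompact K)
    (h0 : 0 ∉ K) : ∃ (f : testSpace n) (r : ℝ), 0 < r ∧
      (∀ i j, coord i (deriv j f) = coord j (deriv i f)) ∧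
      (∀ x ∈ K, (f : EuclideanSpace ℝ (Fin n) → ℝ) =ᶠ[nhds x] fun _ => 1) ∧
      tsupport (f : EuclideanSpace ℝ (Fin n) → ℝ) ⊆ Metric.ball 0 r ∧ K ⊆ Metric.ball 0 r := by
  obtain ⟨δ, hδ, hδK⟩ := Metric.isOpen_iff.1 hK.isClosed.isOpen_compl 0 h0
  obtain ⟨R, hR, hRK⟩ := hK.isBounded.subset_ball_lt 0 (0 : EuclideanSpace ℝ (Fin n))
  have hb : 0 < δ ^ 2 := by positivity
  have hR2 : 0 < R ^ 2 := by positivity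
  let g : ContDiffBump ((δ ^ 2 + (R ^ 2 + δ ^ 2)) / 2 : ℝ) :=
    ⟨R ^ 2 / 2 + δ ^ 2 / 4, R ^ 2 / 2 + δ ^ 2 / 2, by positivity, by linarith⟩
  have hgd : ContDiff ℝ (⊤ : ℕ∞) (g : ℝ → ℝ) := g.contDiff
  have hg0 : ∀ t, ¬ (δ ^ 2 / 2 ≤ t ∧ t ≤ R ^ 2 + 3 / 2 * δ ^ 2) → g t = 0 := by
    intro t ht
    refine g.zero_of_le_dist ?_
    by_contra! hlt
    rw [Real.dist_eq, abs_lt] at hlt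
    refine ht ⟨?_, ?_⟩
    · linarith [hlt.1, show g.rOut = R ^ 2 / 2 + δ ^ 2 / 2 from rfl]
    · linarith [hlt.2, show g.rOut = R ^ 2 / 2 + δ ^ 2 / 2 from rfl]
  let F : EuclideanSpace ℝ (Fin n) → ℝ := fun x => g (‖x‖ ^ 2)
  have hFs : tsupport F ⊆ {x | δ ^ 2 / 2 ≤ ‖x‖ ^ 2 ∧ ‖x‖ ^ 2 ≤ R ^ 2 + 3 / 2 * δ ^ 2} := by
    refine closure_minimal (fun x hx => ?_) ?_
    · by_contra h
      exact hx (hg0 _ h)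
    · exact (isClosed_le continuous_const (continuous_norm.pow 2)).inter
        (isClosed_le (continuous_norm.pow 2) continuous_const)
  have hFb : tsupport F ⊆ Metric.ball 0 (R + 2 * δ) := fun x hx => by
    rw [mem_ball_zero_iff]
    refine lt_of_pow_lt_pow_left₀ 2 (by positivity) ((hFs hx).2.trans_lt ?_)
    nlinarith
  refine ⟨⟨F, hgd.comp (contDiff_norm_sq ℝ), ?_, ?_⟩, R + 2 * δ, by positivity, ?_, ?_, hFb, ?_⟩
  · exact (Metric.isBounded_ball.subset hFb).isCompact_closure.of_isClosed_subset
      (isClosed_tsupport _) subset_closure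
  · intro h
    have := (hFs h).1
    simp at this
    linarith
  · exact coord_deriv_comm_of_radial (g := g)
      (fun t _ => hgd.differentiable (by simp) t) fun x _ => rfl
  · intro x hx
    have h1 : ‖x‖ < R := by simpa using hRK hx
    have h2 : δ ≤ ‖x‖ := by
      by_contra! h
      exact hδK (by simpa using h) hx
    have hopen : IsOpen {y : EuclideanSpace ℝ (Fin n) |
        ‖y‖ ^ 2 ∈ Metric.ball ((δ ^ 2 + (R ^ 2 + δ ^ 2)) / 2 : ℝ) (R ^ 2 / 2 + δ ^ 2 / 4)} :=
      Metric.isOpen_ball.preimage (by fun_prop)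
    have hx' : ‖x‖ ^ 2
        ∈ Metric.ball ((δ ^ 2 + (R ^ 2 + δ ^ 2)) / 2 : ℝ) (R ^ 2 / 2 + δ ^ 2 / 4) := by
      rw [Metric.mem_ball, Real.dist_eq, abs_lt]
      have h3 : ‖x‖ ^ 2 < R ^ 2 := by gcongr
      have h4 : δ ^ 2 ≤ ‖x‖ ^ 2 := by gcongr
      constructor <;> linarith
    filter_upwards [hopen.mem_nhds hx'] with y hy
    exact g.one_of_mem_closedBall (Metric.ball_subset_closedBall hy)
  · exact hRK.trans (Metric.ball_subset_ball (by linarith))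

end testSpace

/-! ### Landau approximation by polynomials -/

section Landau

open Filter Topology

variable {n : ℕ}

/-- The unnormalised Landau kernel. -/
noncomputable def landauKernel (r : ℝ) (m : ℕ) : EuclideanSpace ℝ (Fin n) → ℝ :=
  (Metric.closedBall 0 (2 * r)).indicator fun z => ((2 * r) ^ 2 - ‖z‖ ^ 2) ^ m

/-- Convolution with the normalised Landau kernel. -/
noncomputable def landau (r : ℝ) (m : ℕ) (f : EuclideanSpace ℝ (Fin n) → ℝ)
    (x : EuclideanSpace ℝ (Fin n)) : ℝ :=
  (∫ z : EuclideanSpace ℝ (Fin n), landauKernel r m z)⁻¹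
    * convolution (landauKernel r m) f (ContinuousLinearMap.mul ℝ ℝ) volume x

theorem integrable_landauKernel (r : ℝ) (m : ℕ) :
    Integrable (landauKernel (n := n) r m) :=
  (integrable_indicator_iff Metric.isClosed_closedBall.measurableSet).2
    (ContinuousOn.integrableOn_compact (isCompact_closedBall _ _)
      (by fun_prop : Continuous fun z : EuclideanSpace ℝ (Fin n) =>
        ((2 * r) ^ 2 - ‖z‖ ^ 2) ^ m).continuousOn)

theorem landauKernel_nonneg (r : ℝ) (m : ℕ) (z : EuclideanSpace ℝ (Fin n)) :
    0 ≤ landauKernel r m z := by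
  refine Set.indicator_nonneg (fun z hz => pow_nonneg ?_ m) z
  have hz' : ‖z‖ ≤ 2 * r := by simpa using hz
  have := pow_le_pow_left₀ (norm_nonneg z) hz' 2
  linarith

theorem partialDeriv_landau (r : ℝ) (m : ℕ) (i : Fin n) {f : EuclideanSpace ℝ (Fin n) → ℝ}
    (hf : ContDiff ℝ 1 f) (hfc : HasCompactSupport f) :
    partialDeriv i (landau r m f) = landau r m (partialDeriv i f) := by
  ext x
  have hk := (integrable_landauKernel (n := n) r m).locallyIntegrable
  have h := (hfc.hasFDerivAt_convolution_right (ContinuousLinearMap.mul ℝ ℝ) hk hf x).const_mul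
    (∫ z : EuclideanSpace ℝ (Fin n), landauKernel r m z)⁻¹
  have h' : fderiv ℝ (landau r m f) x = _ := h.fderiv
  rw [partialDeriv, h', smul_apply,
    convolution_precompR_apply _ hk (hfc.fderiv ℝ) (hf.continuous_fderiv one_ne_zero)]
  rfl

theorem abs_landau_le (r : ℝ) (m : ℕ) {f : EuclideanSpace ℝ (Fin n) → ℝ} {B : ℝ}
    (hB : 0 ≤ B) (hf : ∀ x, |f x| ≤ B) (x : EuclideanSpace ℝ (Fin n)) : |landau r m f x| ≤ B := by
  have h0 : 0 ≤ ∫ z : EuclideanSpace ℝ (Fin n), landauKernel r m z :=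
    integral_nonneg (landauKernel_nonneg r m)
  rw [landau, abs_mul, abs_inv, abs_of_nonneg h0]
  have h1 : |convolution (landauKernel r m) f (ContinuousLinearMap.mul ℝ ℝ) volume x|
      ≤ (∫ z : EuclideanSpace ℝ (Fin n), landauKernel r m z) * B := by
    rw [convolution_def, ← integral_mul_const, ← Real.norm_eq_abs]
    refine norm_integral_le_of_norm_le ((integrable_landauKernel r m).mul_const B)
      (Eventually.of_forall fun z => ?_)
    rw [ContinuousLinearMap.mul_apply', norm_mul, Real.norm_eq_abs, Real.norm_eq_abs,
      abs_of_nonneg (landauKernel_nonneg r m z)]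
    exact mul_le_mul_of_nonneg_left (hf _) (landauKernel_nonneg r m z)
  refine (mul_le_mul_of_nonneg_left h1 (inv_nonneg.2 h0)).trans ?_
  rw [← mul_assoc]
  exact mul_le_of_le_one_left hB inv_mul_le_one

theorem tendsto_landau {r : ℝ} (hr : 0 < r) {f : EuclideanSpace ℝ (Fin n) → ℝ}
    (hf : Continuous f) (x : EuclideanSpace ℝ (Fin n)) :
    Tendsto (fun m => landau r m f x) atTop (𝓝 (f x)) := by
  have h := tendsto_setIntegral_pow_smul_of_unique_maximum_of_isCompact_of_continuousOn
    (μ := (volume : Measure (EuclideanSpace ℝ (Fin n)))) (x₀ := 0)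
    (isCompact_closedBall (0 : EuclideanSpace ℝ (Fin n)) (2 * r))
    (c := fun z => (2 * r) ^ 2 - ‖z‖ ^ 2) (g := fun z => f (x - z))
    (by fun_prop) (fun y _ hy => by have := norm_pos_iff.2 hy; simp; positivity)
    (fun z hz => by
      have hz' : ‖z‖ ≤ 2 * r := by simpa using hz
      have := pow_le_pow_left₀ (norm_nonneg z) hz' 2
      linarith) (by simp; positivity)
    (subset_closure (mem_interior_iff_mem_nhds.2 (Metric.closedBall_mem_nhds 0 (by positivity))))
    (by fun_prop)
  rw [sub_zero] at h
  refine h.congr fun m => ?_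
  have hm := (Metric.isClosed_closedBall (x := (0 : EuclideanSpace ℝ (Fin n)))
    (ε := 2 * r)).measurableSet
  rw [landau, convolution_def, smul_eq_mul]
  congr 1
  · rw [landauKernel, integral_indicator hm]
  · rw [← integral_indicator hm]
    refine integral_congr_ae (Eventually.of_forall fun z => ?_)
    exact (Set.indicator_mul_left _ _ fun z => f (x - z))

theorem exists_polynomial_eq_integral (c : ℝ) (m : ℕ) {f : EuclideanSpace ℝ (Fin n) → ℝ}
    (hf : Continuous f) (hfc : HasCompactSupport f) :
    ∃ p : MvPolynomial (Fin n) ℝ, ∀ x : EuclideanSpace ℝ (Fin n),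
      ∫ y, (c - ‖x - y‖ ^ 2) ^ m * f y = MvPolynomial.eval x.ofLp p := by
  let Y : Fin n → C(EuclideanSpace ℝ (Fin n), ℝ) := fun i => ⟨fun y => y i, by fun_prop⟩
  let P : MvPolynomial (Fin n) C(EuclideanSpace ℝ (Fin n), ℝ) :=
    (MvPolynomial.C (ContinuousMap.const _ c)
      - ∑ i, (MvPolynomial.X i - MvPolynomial.C (Y i)) ^ 2) ^ m
  let ev : EuclideanSpace ℝ (Fin n) → C(EuclideanSpace ℝ (Fin n), ℝ) →+* ℝ := fun y =>
    (ContinuousMap.evalAlgHom ℝ ℝ y).toRingHom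
  have hP : ∀ x y : EuclideanSpace ℝ (Fin n),
      (c - ‖x - y‖ ^ 2) ^ m = MvPolynomial.eval₂ (ev y) x.ofLp P := by
    intro x y
    simp only [P, MvPolynomial.eval₂_pow, MvPolynomial.eval₂_sub, MvPolynomial.eval₂_C,
      MvPolynomial.eval₂_sum, MvPolynomial.eval₂_X, EuclideanSpace.real_norm_sq_eq]
    rfl
  refine ⟨∑ s ∈ P.support, MvPolynomial.monomial s (∫ y, P.coeff s y * f y), fun x => ?_⟩
  have h1 : ∀ y, (c - ‖x - y‖ ^ 2) ^ m * f y
      = ∑ s ∈ P.support, (P.coeff s y * f y) * ∏ i, x i ^ s i := by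
    intro y
    rw [hP, MvPolynomial.eval₂_eq', Finset.sum_mul]
    exact Finset.sum_congr rfl fun s _ => mul_right_comm _ _ _
  simp only [h1]
  rw [integral_finsetSum, map_sum]
  · refine Finset.sum_congr rfl fun s _ => ?_
    rw [integral_mul_const, MvPolynomial.eval_monomial, Finsupp.prod_fintype _ _ (by simp)]
  · intro s _
    exact (((P.coeff s).continuous.mul hf).integrable_of_hasCompactSupport
      hfc.mul_left).mul_const _

theorem exists_polynomial_eq_landau (r : ℝ) (m : ℕ) {f : EuclideanSpace ℝ (Fin n) → ℝ}
    (hf : Continuous f) (hfc : HasCompactSupport f) (hfr : tsupport f ⊆ Metric.ball 0 r) :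
    ∃ p : MvPolynomial (Fin n) ℝ, ∀ x ∈ Metric.ball (0 : EuclideanSpace ℝ (Fin n)) r,
      landau r m f x = MvPolynomial.eval x.ofLp p := by
  obtain ⟨p, hp⟩ := exists_polynomial_eq_integral ((2 * r) ^ 2) m hf hfc
  refine ⟨MvPolynomial.C (∫ z : EuclideanSpace ℝ (Fin n), landauKernel r m z)⁻¹ * p,
    fun x hx => ?_⟩
  rw [map_mul, MvPolynomial.eval_C, landau, ← hp x, convolution_def]
  congr 1
  rw [← integral_sub_left_eq_self _ _ x]
  refine integral_congr_ae (Eventually.of_forall fun y => ?_)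
  simp only [ContinuousLinearMap.mul_apply', sub_sub_cancel]
  by_cases hy : f y = 0
  · simp [hy]
  · have hyr := hfr (subset_tsupport f hy)
    rw [landauKernel, Set.indicator_of_mem]
    rw [mem_ball_zero_iff] at hx hyr
    rw [mem_closedBall_zero_iff]
    linarith [norm_sub_le x y]

end Landau

/-! ### The inequality for twice differentiable functions -/

section PartialDeriv

variable {n : ℕ} {f : EuclideanSpace ℝ (Fin n) → ℝ}

theorem contDiff_partialDeriv {k l : WithTop ℕ∞} (hf : ContDiff ℝ k f) (hkl : l + 1 ≤ k)
    (i : Fin n) : ContDiff ℝ l (partialDeriv i f) :=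
  (hf.fderiv_right hkl).clm_apply contDiff_const

theorem tsupport_partialDeriv_subset (f : EuclideanSpace ℝ (Fin n) → ℝ) (i : Fin n) :
    tsupport (partialDeriv i f) ⊆ tsupport f :=
  tsupport_fderiv_apply_subset ℝ (EuclideanSpace.single i 1)

theorem hasCompactSupport_partialDeriv (hf : HasCompactSupport f) (i : Fin n) :
    HasCompactSupport (partialDeriv i f) :=
  hf.of_isClosed_subset (isClosed_tsupport _) (tsupport_partialDeriv_subset f i)

theorem partialDeriv_congr {g : EuclideanSpace ℝ (Fin n) → ℝ} {x : EuclideanSpace ℝ (Fin n)}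
    (h : f =ᶠ[nhds x] g) (i : Fin n) : partialDeriv i f =ᶠ[nhds x] partialDeriv i g := by
  filter_upwards [h.fderiv (𝕜 := ℝ)] with y hy
  rw [partialDeriv, partialDeriv, hy]

end PartialDeriv

section Approximation

open Filter Topology

variable {n : ℕ}

/-- Bounded pointwise convergence of polynomials on a ball. -/
def PolyTendsto (r : ℝ) (p : ℕ → MvPolynomial (Fin n) ℝ)
    (f : EuclideanSpace ℝ (Fin n) → ℝ) : Prop :=
  ∃ B : ℝ, (∀ m, ∀ x ∈ Metric.ball (0 : EuclideanSpace ℝ (Fin n)) r,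
      |MvPolynomial.eval x.ofLp (p m)| ≤ B) ∧
    ∀ x ∈ Metric.ball (0 : EuclideanSpace ℝ (Fin n)) r,
      Tendsto (fun m => MvPolynomial.eval x.ofLp (p m)) atTop (𝓝 (f x))

theorem polyTendsto_of_eq_landau {r : ℝ} (hr : 0 < r) {p : ℕ → MvPolynomial (Fin n) ℝ}
    {f : EuclideanSpace ℝ (Fin n) → ℝ} (hf : Continuous f) (hfc : HasCompactSupport f)
    (h : ∀ m, ∀ x ∈ Metric.ball (0 : EuclideanSpace ℝ (Fin n)) r,
      landau r m f x = MvPolynomial.eval x.ofLp (p m)) : PolyTendsto r p f := by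
  obtain ⟨B, hB⟩ := hf.bounded_above_of_compact_support hfc
  refine ⟨B, fun m x hx => ?_, fun x hx => ?_⟩
  · rw [← h m x hx]
    exact abs_landau_le r m ((norm_nonneg _).trans (hB 0)) hB x
  · exact (tendsto_landau hr hf x).congr fun m => h m x hx

theorem eval_pderiv_of_eq_landau {r : ℝ} {m : ℕ} {p : MvPolynomial (Fin n) ℝ}
    {f : EuclideanSpace ℝ (Fin n) → ℝ} (hf : ContDiff ℝ 1 f) (hfc : HasCompactSupport f)
    (h : ∀ x ∈ Metric.ball (0 : EuclideanSpace ℝ (Fin n)) r,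
      landau r m f x = MvPolynomial.eval x.ofLp p) (i : Fin n) :
    ∀ x ∈ Metric.ball (0 : EuclideanSpace ℝ (Fin n)) r,
      landau r m (partialDeriv i f) x = MvPolynomial.eval x.ofLp (MvPolynomial.pderiv i p) := by
  intro x hx
  rw [← partialDeriv_landau r m i hf hfc, ← MvPolynomial.partialDeriv_eval]
  refine (partialDeriv_congr ?_ i).self_of_nhds
  filter_upwards [Metric.isOpen_ball.mem_nhds hx] with y hy using h y hy

/-- Every compactly supported function of class `C²` is approximated on a ball, together with its
derivatives, by polynomials. -/
theorem exists_polyTendsto {r : ℝ} (hr : 0 < r) {u : EuclideanSpace ℝ (Fin n) → ℝ}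
    (hu : ContDiff ℝ 2 u) (huc : HasCompactSupport u) (hur : tsupport u ⊆ Metric.ball 0 r) :
    ∃ p : ℕ → MvPolynomial (Fin n) ℝ, PolyTendsto r p u ∧
      (∀ i, PolyTendsto r (fun m => MvPolynomial.pderiv i (p m)) (partialDeriv i u)) ∧
      ∀ i, PolyTendsto r (fun m => MvPolynomial.pderiv i (MvPolynomial.pderiv i (p m)))
        (partialDeriv i (partialDeriv i u)) := by
  choose p hp using fun m => exists_polynomial_eq_landau r m hu.continuous huc hur
  have hu1 : ∀ i, ContDiff ℝ 1 (partialDeriv i u) := contDiff_partialDeriv hu (by norm_num)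
  have hp1 := fun m => eval_pderiv_of_eq_landau (hu.of_le (by norm_num)) huc (hp m)
  have hp2 := fun m i =>
    eval_pderiv_of_eq_landau (hu1 i) (hasCompactSupport_partialDeriv huc i) (hp1 m i) i
  refine ⟨p, polyTendsto_of_eq_landau hr hu.continuous huc hp, fun i => ?_, fun i => ?_⟩
  · exact polyTendsto_of_eq_landau hr (hu1 i).continuous (hasCompactSupport_partialDeriv huc i)
      fun m => hp1 m i
  · exact polyTendsto_of_eq_landau hr
      (contDiff_partialDeriv (l := 0) (hu1 i) (by simp) i).continuous
      (hasCompactSupport_partialDeriv (hasCompactSupport_partialDeriv huc i) i) fun m => hp2 m i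

namespace testSpace

/-- Bounded pointwise convergence of test functions with supports in a common compact set. -/
def TendstoBdd (w : ℕ → testSpace n) (f : EuclideanSpace ℝ (Fin n) → ℝ) : Prop :=
  ∃ K : Set (EuclideanSpace ℝ (Fin n)), IsCompact K ∧ 0 ∉ K ∧ (∀ m, ∀ x ∉ K, w m x = 0) ∧
    (∃ B : ℝ, ∀ m x, |w m x| ≤ B) ∧ ∀ x, Tendsto (fun m => w m x) atTop (𝓝 (f x))

theorem TendstoBdd.add {w w' : ℕ → testSpace n} {f f' : EuclideanSpace ℝ (Fin n) → ℝ}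
    (h : TendstoBdd w f) (h' : TendstoBdd w' f') :
    TendstoBdd (fun m => w m + w' m) (fun x => f x + f' x) := by
  obtain ⟨K, hK, h0, hw, ⟨B, hB⟩, ht⟩ := h
  obtain ⟨K', hK', h0', hw', ⟨B', hB'⟩, ht'⟩ := h'
  refine ⟨K ∪ K', hK.union hK', fun h => h.elim h0 h0', fun m x hx => ?_, ⟨B + B', fun m x => ?_⟩,
    fun x => (ht x).add (ht' x)⟩
  · have h1 := hw m x fun h => hx (Or.inl h)
    have h2 := hw' m x fun h => hx (Or.inr h)
    simp [h1, h2]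
  · exact (abs_add_le _ _).trans (add_le_add (hB m x) (hB' m x))

theorem TendstoBdd.sum {ι : Type*} (s : Finset ι) {w : ι → ℕ → testSpace n}
    {f : ι → EuclideanSpace ℝ (Fin n) → ℝ} (h : ∀ i, TendstoBdd (w i) (f i)) :
    TendstoBdd (fun m => ∑ i ∈ s, w i m) (fun x => ∑ i ∈ s, f i x) := by
  classical
  induction s using Finset.induction_on with
  | empty =>
    simp only [Finset.sum_empty]
    exact ⟨∅, isCompact_empty, by simp, fun m x _ => rfl, ⟨0, fun m x => by simp⟩,
      fun x => tendsto_const_nhds⟩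
  | insert i s hi ih =>
    simp only [Finset.sum_insert hi]
    exact (h i).add ih

theorem tendstoBdd_polyMul {r : ℝ} {p : ℕ → MvPolynomial (Fin n) ℝ}
    {f : EuclideanSpace ℝ (Fin n) → ℝ} (h : PolyTendsto r p f) {g : testSpace n}
    (hg : tsupport (g : EuclideanSpace ℝ (Fin n) → ℝ) ⊆ Metric.ball 0 r) :
    TendstoBdd (fun m => polyMul (p m) g) (fun x => f x * g x) := by
  obtain ⟨B, hB, ht⟩ := h
  obtain ⟨B', hB'⟩ :=
    (contDiff g).continuous.bounded_above_of_compact_support (hasCompactSupport g)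
  refine ⟨_, hasCompactSupport g, zero_notMem g, fun m x hx => ?_, ⟨|B| * B', fun m x => ?_⟩,
    fun x => ?_⟩
  · simp [image_eq_zero_of_notMem_tsupport hx]
  · rw [coe_polyMul, abs_mul]
    by_cases hx : x ∈ tsupport (g : EuclideanSpace ℝ (Fin n) → ℝ)
    · exact mul_le_mul ((hB m x (hg hx)).trans (le_abs_self B)) (hB' x) (abs_nonneg _)
        (abs_nonneg _)
    · rw [image_eq_zero_of_notMem_tsupport hx, abs_zero, mul_zero]
      exact mul_nonneg (abs_nonneg _) ((norm_nonneg _).trans (hB' 0))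
  · by_cases hx : x ∈ tsupport (g : EuclideanSpace ℝ (Fin n) → ℝ)
    · exact (ht x (hg hx)).mul_const _
    · simp [image_eq_zero_of_notMem_tsupport hx]

theorem TendstoBdd.tendsto_form (s : ℝ) {w : ℕ → testSpace n}
    {f : EuclideanSpace ℝ (Fin n) → ℝ} (h : TendstoBdd w f) :
    Tendsto (fun m => form s (w m) (w m)) atTop (𝓝 (∫ x, ‖x‖ ^ s * (f x * f x))) := by
  obtain ⟨K, hK, h0, hw, ⟨B, hB⟩, ht⟩ := h
  have hcont : ContinuousOn (fun x : EuclideanSpace ℝ (Fin n) => ‖x‖ ^ s * B ^ 2) K :=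
    ((contDiffOn_norm_rpow s).continuousOn.mono fun x hx (h : x = 0) => h0 (h ▸ hx)).mul
      continuousOn_const
  simp only [form_eq_integral]
  refine tendsto_integral_of_dominated_convergence
    (K.indicator fun x => ‖x‖ ^ s * B ^ 2) (fun m => ?_)
    ((integrable_indicator_iff hK.measurableSet).2 (hcont.integrableOn_compact hK))
    (fun m => Eventually.of_forall fun x => ?_) (Eventually.of_forall fun x => ?_)
  · exact (integrable (normPow s (prod (w m) (w m)))).aestronglyMeasurable
  · by_cases hx : x ∈ K
    · rw [Set.indicator_of_mem hx, norm_mul, Real.norm_of_nonneg (by positivity)]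
      refine mul_le_mul_of_nonneg_left ?_ (by positivity)
      rw [Real.norm_eq_abs, abs_mul, ← sq]
      exact pow_le_pow_left₀ (abs_nonneg _) (hB m x) 2
    · rw [Set.indicator_of_notMem hx, hw m x hx]
      simp
  · exact ((ht x).mul (ht x)).const_mul _

end testSpace

end Approximation

open testSpace Filter Topology in
/-- The weighted Hardy–Rellich inequality for `C²` functions supported away from the origin. -/
theorem rellich_of_contDiff {n : ℕ} (hn : 2 ≤ n) {α : ℝ} (hα : α ≠ 4 - n)
    {u : EuclideanSpace ℝ (Fin n) → ℝ} (hu : ContDiff ℝ 2 u) (huc : HasCompactSupport u)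
    (hu0 : 0 ∉ tsupport u) :
    rellichConst n α * ∑ j, ∫ x, ‖x‖ ^ (α - 2) * (partialDeriv j u x * partialDeriv j u x)
      ≤ ∫ x, ‖x‖ ^ α * ((∑ i, partialDeriv i (partialDeriv i u) x)
          * ∑ i, partialDeriv i (partialDeriv i u) x) := by
  obtain ⟨ζ, r, hr, hrad, hζ1, hζr, hur⟩ := exists_radial_cutoff huc hu0
  obtain ⟨p, hp, hp1, hp2⟩ := exists_polyTendsto hr hu huc hur
  have hd : ∀ i (f : testSpace n), tsupport (f : EuclideanSpace ℝ (Fin n) → ℝ) ⊆ Metric.ball 0 r →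
      tsupport (deriv i f : EuclideanSpace ℝ (Fin n) → ℝ) ⊆ Metric.ball 0 r := fun i f hf =>
    (tsupport_partialDeriv_subset _ i).trans hf
  have hζ : ∀ x, (∀ i, u x * partialDeriv i ζ x = 0) ∧
      (∀ i, partialDeriv i u x * partialDeriv i ζ x = 0) ∧
      (∀ i, u x * partialDeriv i (partialDeriv i ζ) x = 0) ∧
      (∀ i, partialDeriv i u x * ζ x = partialDeriv i u x) ∧
      ∀ i, partialDeriv i (partialDeriv i u) x * ζ x = partialDeriv i (partialDeriv i u) x := by
    intro x
    by_cases hx : x ∈ tsupport u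
    · have h1 : ∀ i, partialDeriv i ζ =ᶠ[𝓝 x] fun _ => 0 := fun i =>
        (partialDeriv_congr (hζ1 x hx) i).trans (Eventually.of_forall fun y => by
          simp [partialDeriv])
      have h2 : ∀ i, partialDeriv i (partialDeriv i ζ) x = 0 := fun i =>
        (partialDeriv_congr (h1 i) i).self_of_nhds.trans (by simp [partialDeriv])
      have h3 := fun i => (h1 i).self_of_nhds
      have h4 := (hζ1 x hx).self_of_nhds
      simp [h2, h3, h4]
    · have h1 : ∀ i, x ∉ tsupport (partialDeriv i u) := fun i h =>
        hx (tsupport_partialDeriv_subset u i h)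
      have h2 : ∀ i, x ∉ tsupport (partialDeriv i (partialDeriv i u)) := fun i h =>
        h1 i (tsupport_partialDeriv_subset _ i h)
      have h3 := fun i => image_eq_zero_of_notMem_tsupport (h1 i)
      have h4 := fun i => image_eq_zero_of_notMem_tsupport (h2 i)
      simp [image_eq_zero_of_notMem_tsupport hx, h3, h4]
  have hgrad : ∀ j, TendstoBdd (fun m => deriv j (polyMul (p m) ζ)) (partialDeriv j u) := by
    intro j
    simp only [deriv_polyMul]
    convert (tendstoBdd_polyMul hp (hd j ζ hζr)).add (tendstoBdd_polyMul (hp1 j) hζr) using 2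
      with x
    rw [coe_deriv, (hζ x).1, (hζ x).2.2.2.1, zero_add]
  have hlap : TendstoBdd (fun m => laplacian (polyMul (p m) ζ))
      (fun x => ∑ i, partialDeriv i (partialDeriv i u) x) := by
    simp only [laplacian_apply, deriv_polyMul, map_add]
    refine TendstoBdd.sum _ fun i => ?_
    convert ((tendstoBdd_polyMul hp (hd i _ (hd i ζ hζr))).add
      (tendstoBdd_polyMul (hp1 i) (hd i ζ hζr))).add
      ((tendstoBdd_polyMul (hp1 i) (hd i ζ hζr)).add (tendstoBdd_polyMul (hp2 i) hζr)) using 2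
      with x
    rw [coe_deriv, coe_deriv, (hζ x).2.1, (hζ x).2.2.1, (hζ x).2.2.2.2]
    ring
  refine le_of_tendsto_of_tendsto
    ((tendsto_finsetSum _ fun j _ => (hgrad j).tendsto_form (α - 2)).const_mul _)
    (hlap.tendsto_form α) (Eventually.of_forall fun m => rellich_polyMul hn hα (p m) hrad)

/-! ### Harmonic polynomials -/

namespace MvPolynomial

theorem polyLaplacian_X_mul {n : ℕ} (i : Fin n) (p : MvPolynomial (Fin n) ℝ) :
    polyLaplacian n (X i * p) = X i * polyLaplacian n p + 2 * pderiv i p := by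
  have h : ∀ j, pderiv j (pderiv j (X i * p))
      = X i * pderiv j (pderiv j p) + if j = i then 2 * pderiv j p else 0 := by
    intro j
    rcases eq_or_ne j i with rfl | hji
    · simp [Derivation.leibniz]
      ring
    · simp [Derivation.leibniz, pderiv_X_of_ne hji.symm, hji]
  rw [polyLaplacian_apply, polyLaplacian_apply, Finset.sum_congr rfl fun j _ => h j,
    Finset.sum_add_distrib, Finset.mul_sum]
  simp

/-- The real and imaginary parts of `(xᵢ + √-1 xⱼ)^k` are harmonic conjugate polynomials. -/
theorem exists_harmonic_pair {n : ℕ} {i j : Fin n} (hij : i ≠ j) (k : ℕ) :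
    ∃ p q : MvPolynomial (Fin n) ℝ, p.IsHomogeneous k ∧ q.IsHomogeneous k ∧
      polyLaplacian n p = 0 ∧ polyLaplacian n q = 0 ∧
      pderiv i p = pderiv j q ∧ pderiv j p = -pderiv i q ∧
      eval (Pi.single i 1) p = (1 : ℝ) := by
  induction k with
  | zero =>
    refine ⟨1, 0, isHomogeneous_one _ _, isHomogeneous_zero _ _ _, ?_, by simp, ?_, ?_,
      by simp⟩ <;> simp [polyLaplacian_apply]
  | succ k ih =>
    obtain ⟨p, q, hp, hq, lp, lq, h1, h2, e⟩ := ih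
    have hX := fun l : Fin n => isHomogeneous_X ℝ l
    rw [add_comm k 1]
    refine ⟨X i * p - X j * q, X i * q + X j * p, ((hX i).mul hp).sub ((hX j).mul hq),
      ((hX i).mul hq).add ((hX j).mul hp), ?_, ?_, ?_, ?_, ?_⟩
    · rw [map_sub, polyLaplacian_X_mul, polyLaplacian_X_mul, lp, lq, h1]
      ring
    · rw [map_add, polyLaplacian_X_mul, polyLaplacian_X_mul, lp, lq, h2]
      ring
    · simp only [map_sub, map_add, Derivation.leibniz, pderiv_X_self, pderiv_X_of_ne hij,
        pderiv_X_of_ne hij.symm, smul_eq_mul, h1, h2]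
      ring
    · simp only [map_sub, map_add, Derivation.leibniz, pderiv_X_self, pderiv_X_of_ne hij,
        pderiv_X_of_ne hij.symm, smul_eq_mul, h1, h2]
      ring
    · simp [e, hij]

theorem IsHomogeneous.eval_smul {σ R : Type*} [CommSemiring R] {p : MvPolynomial σ R} {k : ℕ}
    (hp : p.IsHomogeneous k) (c : R) (x : σ → R) : eval (c • x) p = c ^ k * eval x p := by
  rw [eval_eq, eval_eq, Finset.mul_sum]
  refine Finset.sum_congr rfl fun d hd => ?_
  have hk : ∑ i ∈ d.support, d i = k := by
    simpa [Finsupp.weight_apply, Finsupp.sum] using hp (mem_support_iff.1 hd)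
  simp only [Pi.smul_apply, smul_eq_mul, mul_pow, Finset.prod_mul_distrib,
    Finset.prod_pow_eq_pow_sum, hk]
  ring

theorem exists_harmonic {n : ℕ} (hn : 2 ≤ n) (k : ℕ) :
    ∃ (p : MvPolynomial (Fin n) ℝ) (i : Fin n), p.IsHomogeneous k ∧
      polyAngular n p = sphereEigenvalue n k • p ∧ eval (Pi.single i 1) p = (1 : ℝ) := by
  obtain ⟨p, -, hp, -, h, -, -, -, e⟩ :=
    exists_harmonic_pair (i := (⟨0, by lia⟩ : Fin n)) (j := ⟨1, by lia⟩) (by simp) k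
  exact ⟨p, _, hp, by rw [polyAngular_of_isHomogeneous hp, h, map_zero, sub_zero], e⟩

end MvPolynomial

/-! ### Integration in polar coordinates -/

open Set in
theorem integral_polar_mul {E : Type*} [NormedAddCommGroup E] [NormedSpace ℝ E]
    [MeasurableSpace E] [BorelSpace E] [FiniteDimensional ℝ E] [Nontrivial E]
    (μ : Measure E) [μ.IsAddHaarMeasure] (F : E → ℝ) (f : ℝ → ℝ) :
    ∫ x, F (‖x‖⁻¹ • x) * f ‖x‖ ∂μ = (∫ z, F z.1 ∂μ.toSphere)
      * ∫ y in Ioi (0 : ℝ), y ^ (Module.finrank ℝ E - 1) * f y :=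
  calc
    ∫ x, F (‖x‖⁻¹ • x) * f ‖x‖ ∂μ
      = ∫ x : ({(0)}ᶜ : Set E), F (‖x.1‖⁻¹ • x.1) * f (‖x.1‖) ∂(μ.comap (↑)) := by
      rw [integral_subtype_comap (measurableSet_singleton _).compl
        fun x => F (‖x‖⁻¹ • x) * f ‖x‖, restrict_compl_singleton]
    _ = ∫ x, F x.1 * f x.2 ∂μ.toSphere.prod (.volumeIoiPow (Module.finrank ℝ E - 1)) := by
      simpa using μ.measurePreserving_homeomorphUnitSphereProd.integral_comp
        (Homeomorph.measurableEmbedding _) (fun x => F x.1 * f x.2)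
    _ = (∫ z, F z.1 ∂μ.toSphere)
        * ∫ x : Ioi (0 : ℝ), f x ∂.volumeIoiPow (Module.finrank ℝ E - 1) :=
      integral_prod_mul (fun z : Metric.sphere (0 : E) 1 => F z) fun x : Ioi (0 : ℝ) => f x
    _ = _ := by
      simp only [Measure.volumeIoiPow, ENNReal.ofReal]
      rw [integral_withDensity_eq_integral_smul,
        integral_subtype_comap measurableSet_Ioi
          fun a => Real.toNNReal (a ^ (Module.finrank ℝ E - 1)) • f a,
        setIntegral_congr_fun measurableSet_Ioi fun x hx => ?_]
      · rw [NNReal.smul_def, Real.coe_toNNReal _ (pow_nonneg hx.out.le _), smul_eq_mul]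
      · exact (measurable_subtype_coe.pow_const _).real_toNNReal

open Set in
theorem integral_inv_mul_log_div (f : ℝ → ℝ) {R : ℝ} (hR : 0 < R) :
    ∫ y in Ioi (0 : ℝ), y⁻¹ * f (Real.log y / R)
      = R * ∫ y in Ioi (0 : ℝ), y⁻¹ * f (Real.log y) := by
  rw [← integral_comp_rpow_Ioi_of_pos (g := fun y => y⁻¹ * f (Real.log y / R)) hR,
    ← integral_const_mul]
  refine setIntegral_congr_fun measurableSet_Ioi fun x (hx : 0 < x) => ?_
  simp only [smul_eq_mul]
  rw [Real.log_rpow hx, mul_div_cancel_left₀ _ hR.ne', Real.rpow_sub_one hx.ne']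
  have := (Real.rpow_pos_of_pos hx R).ne'
  field_simp

/-! ### Logarithmically scaled test functions -/

/-- Smooth functions on the line that vanish outside `[1, 2]`. -/
def IsProfile (ψ : ℝ → ℝ) : Prop := ContDiff ℝ (⊤ : ℕ∞) ψ ∧ ∀ t ∉ Set.Icc 1 2, ψ t = 0

theorem IsProfile.deriv {ψ : ℝ → ℝ} (hψ : IsProfile ψ) : IsProfile (deriv ψ) := by
  refine ⟨(contDiff_infty_iff_deriv.1 hψ.1).2, fun t ht => ?_⟩
  have : ψ =ᶠ[nhds t] fun _ => 0 := by
    filter_upwards [isClosed_Icc.isOpen_compl.mem_nhds ht] with s hs using hψ.2 s hs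
  rw [this.deriv_eq, deriv_const]

theorem exists_isProfile : ∃ ψ, IsProfile ψ ∧ ψ (3 / 2) = 1 := by
  let ψ : ContDiffBump (3 / 2 : ℝ) := ⟨1 / 4, 1 / 2, by norm_num, by norm_num⟩
  refine ⟨ψ, ⟨ψ.contDiff, fun t ht => ψ.zero_of_le_dist ?_⟩,
    ψ.one_of_mem_closedBall (by simp [ψ.rIn_pos.le])⟩
  by_contra! h
  rw [Real.dist_eq, abs_lt] at h
  have : ψ.rOut = 1 / 2 := rfl
  exact ht ⟨by linarith [h.1], by linarith [h.2]⟩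

namespace testSpace

variable {n : ℕ} {ψ : ℝ → ℝ}

/-- The radial test function `ψ (log |x| / R)`. -/
noncomputable def logCutoff (hψ : IsProfile ψ) {R : ℝ} (hR : 0 < R) : testSpace n :=
  ⟨fun x => ψ (Real.log ‖x‖ / R), by
    have hs : tsupport (fun x : EuclideanSpace ℝ (Fin n) => ψ (Real.log ‖x‖ / R))
        ⊆ {x | 1 ≤ ‖x‖ ∧ ‖x‖ ≤ Real.exp (R * 2)} := by
      refine closure_minimal (fun x hx => ?_) ((isClosed_le continuous_const continuous_norm).inter
        (isClosed_le continuous_norm continuous_const))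
      have h : Real.log ‖x‖ / R ∈ Set.Icc 1 2 := by
        by_contra h
        exact hx (hψ.2 _ h)
      have h1 := (le_div_iff₀ hR).1 h.1
      have h2 := (div_le_iff₀ hR).1 h.2
      have h0 : 0 < ‖x‖ := by
        refine (norm_nonneg x).lt_of_ne fun h0 => ?_
        rw [← h0, Real.log_zero] at h1
        linarith
      exact ⟨((Real.log_pos_iff h0.le).1 (by linarith)).le,
        (Real.log_le_iff_le_exp h0).1 (by linarith)⟩
    have h0 : 0 ∉ tsupport (fun x : EuclideanSpace ℝ (Fin n) => ψ (Real.log ‖x‖ / R)) :=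
      fun h => by simpa using (hs h).1.trans_lt' one_pos
    refine ⟨contDiff_iff_contDiffAt.2 fun x => ?_, ?_, h0⟩
    · by_cases hx : x = 0
      · rw [hx]
        exact contDiffAt_const.congr_of_eventuallyEq (notMem_tsupport_iff_eventuallyEq.1 h0)
      · exact hψ.1.contDiffAt.comp x
          (((contDiffAt_id.norm ℝ hx).log (norm_ne_zero_iff.2 hx)).div_const R)
    · refine (isCompact_closedBall 0 (Real.exp (R * 2))).of_isClosed_subset
        (isClosed_tsupport _) fun x hx => ?_
      simpa using (hs hx).2⟩

@[simp] theorem coe_logCutoff (hψ : IsProfile ψ) {R : ℝ} (hR : 0 < R)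
    (x : EuclideanSpace ℝ (Fin n)) :
    (logCutoff hψ hR : testSpace n) x = ψ (Real.log ‖x‖ / R) := rfl

theorem log_norm_eq (x : EuclideanSpace ℝ (Fin n)) :
    Real.log ‖x‖ = Real.log (‖x‖ ^ 2) / 2 := by
  rw [Real.log_pow]; push_cast; ring

theorem hasDerivAt_profile_log (hψ : IsProfile ψ) (R : ℝ) {t : ℝ} (ht : t ≠ 0) :
    HasDerivAt (fun t => ψ (Real.log t / 2 / R)) (_root_.deriv ψ (Real.log t / 2 / R)
      * (t⁻¹ / 2 / R)) t :=
  ((hψ.1.differentiable (by simp) _).hasDerivAt).comp t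
    (((Real.hasDerivAt_log ht).div_const 2).div_const R)

theorem euler_logCutoff (hψ : IsProfile ψ) {R : ℝ} (hR : 0 < R) :
    euler (logCutoff hψ hR : testSpace n) = R⁻¹ • logCutoff hψ.deriv hR := by
  refine ext_of_ne_zero fun x hx => ?_
  have hx' : 0 < ‖x‖ := norm_pos_iff.2 hx
  have h := fun i => partialDeriv_radial i (x := x)
    (hasDerivAt_profile_log hψ R (by positivity : ‖x‖ ^ 2 ≠ 0))
  simp only [← log_norm_eq] at h
  rw [coe_euler]
  simp only [Submodule.coe_smul, Pi.smul_apply, coe_logCutoff, smul_eq_mul]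
  have e : ∀ i, x i * partialDeriv i (logCutoff hψ hR : testSpace n) x
      = _root_.deriv ψ (Real.log ‖x‖ / R) * (‖x‖ ^ 2)⁻¹ / R * x i ^ 2 := fun i => by
    rw [show partialDeriv i (logCutoff hψ hR : testSpace n) x = _ from h i]
    ring
  rw [Finset.sum_congr rfl fun i _ => e i, ← Finset.mul_sum, ← EuclideanSpace.real_norm_sq_eq]
  field_simp

/-- The test function `Y(x) |x|^(a - k) ψ (log |x| / R)`. -/
noncomputable def trial (α : ℝ) (p : MvPolynomial (Fin n) ℝ) (k : ℕ) (hψ : IsProfile ψ) {R : ℝ}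
    (hR : 0 < R) : testSpace n :=
  polyMul p (normPow ((4 - n - α) / 2 - k) (logCutoff hψ hR))

theorem skewEuler_trial (α : ℝ) {p : MvPolynomial (Fin n) ℝ} {k : ℕ} (hp : p.IsHomogeneous k)
    (hψ : IsProfile ψ) {R : ℝ} (hR : 0 < R) :
    skewEuler α (trial α p k hψ hR) = R⁻¹ • trial α p k hψ.deriv hR := by
  simp only [skewEuler_apply, trial, euler_polyMul, euler_normPow, euler_logCutoff, map_add,
    map_smul, MvPolynomial.polyEuler_of_isHomogeneous hp, polyMul_smul]
  module

theorem angular_trial (α : ℝ) {p : MvPolynomial (Fin n) ℝ} {k : ℕ}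
    (hp : MvPolynomial.polyAngular n p = MvPolynomial.sphereEigenvalue n k • p)
    (hψ : IsProfile ψ) {R : ℝ} (hR : 0 < R) :
    angular (trial α p k hψ hR)
      = MvPolynomial.sphereEigenvalue n k • trial α p k hψ hR := by
  rw [trial, angular_polyMul, hp, polyMul_smul]
  refine coord_deriv_comm_of_radial (g := fun t => t ^ (((4 - n - α) / 2 - k) / 2)
    * ψ (Real.log t / 2 / R)) (fun t ht => ?_) fun x hx => ?_
  · exact (Real.differentiableAt_rpow_const_of_ne _ ht.ne').mul
      (hasDerivAt_profile_log hψ R ht.ne').differentiableAt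
  · rw [coe_normPow, coe_logCutoff, ← log_norm_eq, ← Real.rpow_natCast,
      ← Real.rpow_mul (norm_nonneg _)]
    congr 2
    push_cast
    ring

theorem form_trial_self (hn : 2 ≤ n) (α : ℝ) {p : MvPolynomial (Fin n) ℝ} {k : ℕ}
    (hp : p.IsHomogeneous k) (hψ : IsProfile ψ) {R : ℝ} (hR : 0 < R) :
    form (α - 4) (trial α p k hψ hR) (trial α p k hψ hR)
      = R * form (α - 4) (trial α p k hψ one_pos) (trial α p k hψ one_pos) := by
  have : Nontrivial (EuclideanSpace ℝ (Fin n)) :=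
    Module.nontrivial_of_finrank_pos (R := ℝ) (by simp; lia)
  have key : ∀ {R : ℝ} (hR : 0 < R),
      form (α - 4) (trial α p k hψ hR) (trial α p k hψ hR)
        = (∫ z, MvPolynomial.eval z.1.ofLp p ^ 2
            ∂(volume : Measure (EuclideanSpace ℝ (Fin n))).toSphere)
          * ∫ y in Set.Ioi (0 : ℝ), y⁻¹ * ψ (Real.log y / R) ^ 2 := by
    intro R hR
    have hpolar := integral_polar_mul (volume : Measure (EuclideanSpace ℝ (Fin n)))
      (fun x => MvPolynomial.eval x.ofLp p ^ 2)
      fun y => (y ^ n)⁻¹ * ψ (Real.log y / R) ^ 2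
    have h2 : ∫ y in Set.Ioi (0 : ℝ), y⁻¹ * ψ (Real.log y / R) ^ 2
        = ∫ y in Set.Ioi (0 : ℝ), y ^ (Module.finrank ℝ (EuclideanSpace ℝ (Fin n)) - 1)
          * ((y ^ n)⁻¹ * ψ (Real.log y / R) ^ 2) := by
      refine setIntegral_congr_fun measurableSet_Ioi fun y (hy : 0 < y) => ?_
      obtain ⟨m, rfl⟩ : ∃ m, n = m + 1 := ⟨n - 1, by lia⟩
      simp only [finrank_euclideanSpace_fin, Nat.add_sub_cancel, pow_succ]
      field_simp
    rw [h2, ← hpolar, form_eq_integral]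
    refine integral_congr_ae ?_
    filter_upwards [compl_mem_ae_iff.2 (measure_singleton (0 : EuclideanSpace ℝ (Fin n)))]
      with x (hx : x ≠ 0)
    have hx' : 0 < ‖x‖ := norm_pos_iff.2 hx
    have he : MvPolynomial.eval (‖x‖⁻¹ • x).ofLp p
        = (‖x‖ ^ (k : ℝ))⁻¹ * MvPolynomial.eval x.ofLp p := by
      rw [WithLp.ofLp_smul, hp.eval_smul, inv_pow, Real.rpow_natCast]
    have hw : ‖x‖ ^ (α - 4) * (‖x‖ ^ ((4 - n - α) / 2 - k)) ^ 2
        = (‖x‖ ^ n)⁻¹ * ((‖x‖ ^ (k : ℝ))⁻¹) ^ 2 := by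
      rw [← Real.rpow_natCast _ n, ← Real.rpow_neg hx'.le, ← Real.rpow_neg hx'.le,
        ← Real.rpow_natCast, ← Real.rpow_natCast, ← Real.rpow_mul hx'.le, ← Real.rpow_mul hx'.le,
        ← Real.rpow_add hx', ← Real.rpow_add hx']
      congr 1
      push_cast
      ring
    simp only [trial, coe_polyMul, coe_normPow, coe_logCutoff, he]
    linear_combination (MvPolynomial.eval x.ofLp p ^ 2 * ψ (Real.log ‖x‖ / R) ^ 2) * hw
  have h := integral_inv_mul_log_div (fun t => ψ t ^ 2) hR
  rw [key hR, key one_pos, h]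
  simp only [div_one]
  ring

theorem form_trial_self_pos (α : ℝ) {p : MvPolynomial (Fin n) ℝ} {k : ℕ}
    (hp : p.IsHomogeneous k) (hψ : IsProfile ψ) (hψ1 : ψ (3 / 2) ≠ 0) {i : Fin n}
    (hi : MvPolynomial.eval (Pi.single i 1) p = 1) :
    0 < form (α - 4) (trial α p k hψ one_pos) (trial α p k hψ one_pos) := by
  set f : testSpace n := trial α p k hψ one_pos
  change 0 < ∫ x, (normPow (α - 4) (prod f f)) x
  have hnn : ∀ x, 0 ≤ (normPow (α - 4) (prod f f)) x := fun x =>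
    mul_nonneg (Real.rpow_nonneg (norm_nonneg x) _) (mul_self_nonneg _)
  have hcont := (contDiff (normPow (α - 4) (prod f f))).continuous
  refine hcont.integral_pos_of_hasCompactSupport_nonneg_nonzero
    (hasCompactSupport _) hnn (x := Real.exp (3 / 2) • EuclideanSpace.single i 1) ?_
  have he : MvPolynomial.eval
      (Real.exp (3 / 2) • EuclideanSpace.single i (1 : ℝ) : EuclideanSpace ℝ (Fin n)).ofLp p
        = Real.exp (3 / 2) ^ k := by
    rw [WithLp.ofLp_smul, hp.eval_smul, PiLp.ofLp_single, hi, mul_one]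
  have hnorm : ‖(Real.exp (3 / 2) • EuclideanSpace.single i (1 : ℝ) :
      EuclideanSpace ℝ (Fin n))‖ = Real.exp (3 / 2) := by
    rw [norm_smul, PiLp.norm_single, norm_one, mul_one, Real.norm_eq_abs, Real.abs_exp]
  have hpos := Real.exp_pos (3 / 2)
  simp only [f, trial, coe_normPow, coe_prod, coe_polyMul, coe_logCutoff, he, hnorm,
    Real.log_exp, div_one]
  have := fun s : ℝ => (Real.rpow_pos_of_pos hpos s).ne'
  simp [this, hψ1]

open Filter in
theorem le_of_rellich (hn : 2 ≤ n) {α : ℝ} (hα : α ≠ 4 - n) {C : ℝ}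
    (hC : ∀ f : testSpace n, C * ∑ j, form (α - 2) (deriv j f) (deriv j f)
      ≤ form α (laplacian f) (laplacian f)) (k : ℕ) :
    C ≤ (((n : ℝ) - 4 + α) * (n - α) / 4 + MvPolynomial.sphereEigenvalue n k) ^ 2
      / ((((n : ℝ) - 4 + α) / 2) ^ 2 + MvPolynomial.sphereEigenvalue n k) := by
  obtain ⟨p, i, hp, hang, hi⟩ := MvPolynomial.exists_harmonic hn k
  obtain ⟨ψ, hψ, hψ1⟩ := exists_isProfile
  set l := MvPolynomial.sphereEigenvalue n k
  set X := ((n : ℝ) - 4 + α) * (n - α) / 4 + l with hX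
  set H := (((n : ℝ) - 4 + α) / 2) ^ 2 + l with hH
  let N : ∀ {φ : ℝ → ℝ}, IsProfile φ → ℝ := fun hφ =>
    form (α - 4) (trial α p k hφ one_pos) (trial α p k hφ one_pos)
  have hpos : 0 < N hψ := form_trial_self_pos α hp hψ (by simp [hψ1]) hi
  have hle : ∀ R : ℝ, 0 < R → C * ((R ^ 2)⁻¹ * N hψ.deriv + H * N hψ)
      ≤ (R ^ 2)⁻¹ ^ 2 * N hψ.deriv.deriv
        + ((2 - α) ^ 2 + 2 * X) * ((R ^ 2)⁻¹ * N hψ.deriv) + X ^ 2 * N hψ := by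
    intro R hR
    have h := hC (trial α p k hψ hR)
    have e : (((n : ℝ) - 4 + α) * (n - α) / 4) • trial α p k hψ hR + l • trial α p k hψ hR
        = X • trial α p k hψ hR := by rw [hX, add_smul]
    rw [sum_form_deriv_eq_angular, ← form_normSq α (laplacian _), normSq_laplacian α,
      angular_trial α hang, sub_sub, e, form_skew_sq_eq (form_comm _) (form_skewEuler α), skewEuler_trial α hp,
      (skewEuler α).map_smul, skewEuler_trial α hp] at h
    simp only [map_smul, LinearMap.smul_apply, smul_eq_mul, form_trial_self hn α hp _ hR] at h
    refine le_of_mul_le_mul_left ?_ hR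
    change _ ≤ R * (_ + ((2 - α) ^ 2 + 2 * X) * ((R ^ 2)⁻¹ * N hψ.deriv) + X ^ 2 * N hψ)
    convert h using 1
    · simp only [N, hH]; field_simp; ring
    · simp only [N]; field_simp
  have hlim : Tendsto (fun R : ℝ => (R ^ 2)⁻¹) atTop (nhds 0) :=
    tendsto_inv_atTop_zero.comp (tendsto_pow_atTop two_ne_zero)
  have hH0 : 0 < H := hardy_add_sphereEigenvalue_pos hn hα k
  rw [le_div_iff₀ hH0]
  refine le_of_mul_le_mul_right ?_ hpos
  have h := le_of_tendsto_of_tendsto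
    (((hlim.mul_const (N hψ.deriv)).add_const (H * N hψ)).const_mul C)
    ((((hlim.pow 2).mul_const (N hψ.deriv.deriv)).add
      ((hlim.mul_const (N hψ.deriv)).const_mul ((2 - α) ^ 2 + 2 * X))).add_const (X ^ 2 * N hψ))
    ((eventually_gt_atTop 0).mono hle)
  simpa [mul_assoc] using h

end testSpace

/-! ### The two integrals in coordinates -/

section Coordinates

variable {n : ℕ} {u : EuclideanSpace ℝ (Fin n) → ℝ}

theorem lap_eq_sum_partialDeriv (hu : ContDiff ℝ 2 u) (x : EuclideanSpace ℝ (Fin n)) :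
    lap u x = ∑ i, partialDeriv i (partialDeriv i u) x := by
  refine Finset.sum_congr rfl fun i _ => ?_
  have hd : DifferentiableAt ℝ (fderiv ℝ u) x :=
    (hu.fderiv_right (m := 1) (by norm_num)).differentiable (by simp) x
  change _ = fderiv ℝ (fun y => fderiv ℝ u y (EuclideanSpace.single i 1)) x _
  rw [iteratedFDeriv_two_apply, fderiv_clm_apply hd (by fun_prop)]
  simp

theorem norm_gradient_sq (u : EuclideanSpace ℝ (Fin n) → ℝ) (x : EuclideanSpace ℝ (Fin n)) :
    ‖gradient u x‖ ^ 2 = ∑ i, partialDeriv i u x * partialDeriv i u x := by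
  rw [EuclideanSpace.real_norm_sq_eq]
  refine Finset.sum_congr rfl fun i _ => ?_
  have h : gradient u x i = partialDeriv i u x := by
    rw [partialDeriv, ← InnerProductSpace.toDual_symm_apply, EuclideanSpace.inner_single_right]
    simp [gradient]
  rw [h, sq]

theorem integrable_norm_rpow_mul (s : ℝ) {f : EuclideanSpace ℝ (Fin n) → ℝ} (hf : Continuous f)
    (hfc : HasCompactSupport f) (hf0 : 0 ∉ tsupport f) :
    Integrable fun x => ‖x‖ ^ s * f x := by
  refine Continuous.integrable_of_hasCompactSupport (continuous_iff_continuousAt.2 fun x => ?_)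
    hfc.mul_left
  by_cases hx : x = 0
  · have : (fun x => ‖x‖ ^ s * f x) =ᶠ[nhds x] fun _ => 0 := by
      rw [hx]
      filter_upwards [notMem_tsupport_iff_eventuallyEq.1 hf0] with y hy
      simp [hy]
    exact continuousAt_const.congr this.symm
  · exact ((continuous_norm.continuousAt).rpow_const (Or.inl (norm_ne_zero_iff.2 hx))).mul
      hf.continuousAt

theorem integral_norm_gradient_sq (s : ℝ) (hu : ContDiff ℝ 2 u) (huc : HasCompactSupport u)
    (hu0 : 0 ∉ tsupport u) :
    ∫ x, ‖x‖ ^ s * ‖gradient u x‖ ^ 2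
      = ∑ j, ∫ x, ‖x‖ ^ s * (partialDeriv j u x * partialDeriv j u x) := by
  rw [← integral_finsetSum]
  · simp only [norm_gradient_sq, Finset.mul_sum]
  · intro j _
    have hc : Continuous (partialDeriv j u) :=
      (contDiff_partialDeriv (l := 1) hu (by norm_num) j).continuous
    exact integrable_norm_rpow_mul s (hc.mul hc) (hasCompactSupport_partialDeriv huc j).mul_left
      fun h => hu0 (tsupport_partialDeriv_subset u j (tsupport_mul_subset_left h))

theorem integral_lap_sq (s : ℝ) (hu : ContDiff ℝ 2 u) :
    ∫ x, ‖x‖ ^ s * lap u x ^ 2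
      = ∫ x, ‖x‖ ^ s * ((∑ i, partialDeriv i (partialDeriv i u) x)
        * ∑ i, partialDeriv i (partialDeriv i u) x) := by
  simp only [lap_eq_sum_partialDeriv hu, sq]

end Coordinates

namespace testSpace

variable {n : ℕ}

theorem contDiff_two (f : testSpace n) : ContDiff ℝ 2 (f : EuclideanSpace ℝ (Fin n) → ℝ) :=
  (contDiff f).of_le (WithTop.coe_le_coe.2 (le_top (a := (2 : ℕ∞))))

theorem integral_norm_gradient_sq_eq_form (s : ℝ) (f : testSpace n) :
    ∫ x, ‖x‖ ^ s * ‖gradient f x‖ ^ 2 = ∑ j, form s (deriv j f) (deriv j f) :=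
  integral_norm_gradient_sq s (contDiff_two f) (hasCompactSupport f) (zero_notMem f)

theorem integral_lap_sq_eq_form (s : ℝ) (f : testSpace n) :
    ∫ x, ‖x‖ ^ s * lap f x ^ 2 = form s (laplacian f) (laplacian f) := by
  rw [integral_lap_sq s (contDiff_two f), form_eq_integral, laplacian_apply]
  simp

theorem exists_form_deriv_pos (hn : 2 ≤ n) {α : ℝ} (hα : α ≠ 4 - n) :
    ∃ f : testSpace n, 0 < ∑ j, form (α - 2) (deriv j f) (deriv j f) := by
  obtain ⟨p, i, hp, hang, hi⟩ := MvPolynomial.exists_harmonic hn 0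
  obtain ⟨ψ, hψ, hψ1⟩ := exists_isProfile
  refine ⟨trial α p 0 hψ one_pos, ?_⟩
  rw [sum_form_deriv_eq_angular, angular_trial α hang, map_smul, smul_eq_mul]
  have h1 := form_trial_self_pos α hp hψ (by simp [hψ1]) hi
  have h2 := form_self_nonneg (α - 4) (skewEuler α (trial α p 0 hψ one_pos))
  have h3 := mul_pos (hardy_add_sphereEigenvalue_pos hn hα 0) h1
  linarith

end testSpace

theorem statement11 (n : ℕ) (hn : 2 ≤ n) (α : ℝ) (hα : α ≠ 4 - (n : ℝ))
    (γ h : ℝ)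
    (hγ : γ = ((n : ℝ) - 4 + α) * ((n : ℝ) - α) / 4)
    (hh : h = (((n : ℝ) - 4 + α) / 2) ^ 2)
    (hcond : γ ≤ 2 * h) :
    sInf {r : ℝ | ∃ u : EuclideanSpace ℝ (Fin n) → ℝ,
        ContDiff ℝ 2 u ∧ HasCompactSupport u ∧
        (0 : EuclideanSpace ℝ (Fin n)) ∉ tsupport u ∧
        (∫ x : EuclideanSpace ℝ (Fin n), ‖x‖ ^ (α - 2) * ‖gradient u x‖ ^ 2) ≠ 0 ∧
        r = (∫ x : EuclideanSpace ℝ (Fin n), ‖x‖ ^ α * (lap u x) ^ 2) /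
            (∫ x : EuclideanSpace ℝ (Fin n), ‖x‖ ^ (α - 2) * ‖gradient u x‖ ^ 2)} =
      ⨅ k : ℕ, (γ + (k : ℝ) * ((n : ℝ) - 2 + (k : ℝ))) ^ 2 /
        (h + (k : ℝ) * ((n : ℝ) - 2 + (k : ℝ))) := by
  subst hγ hh
  change _ = rellichConst n α
  have hnum : ∀ u : EuclideanSpace ℝ (Fin n) → ℝ, 0 ≤ ∫ x, ‖x‖ ^ α * lap u x ^ 2 :=
    fun u => integral_nonneg fun x => mul_nonneg (Real.rpow_nonneg (norm_nonneg x) _) (sq_nonneg _)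
  have hden : ∀ u : EuclideanSpace ℝ (Fin n) → ℝ, 0 ≤ ∫ x, ‖x‖ ^ (α - 2) * ‖gradient u x‖ ^ 2 :=
    fun u => integral_nonneg fun x => mul_nonneg (Real.rpow_nonneg (norm_nonneg x) _) (sq_nonneg _)
  refine le_antisymm (le_ciInf fun k => testSpace.le_of_rellich hn hα (fun f => ?_) k)
    (le_csInf ?_ ?_)
  · rw [← testSpace.integral_norm_gradient_sq_eq_form, ← testSpace.integral_lap_sq_eq_form]
    rcases (hden f).eq_or_lt with h0 | h0
    · rw [← h0, mul_zero]
      exact hnum f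
    · refine (le_div_iff₀ h0).1 (csInf_le ⟨0, ?_⟩ ⟨f, testSpace.contDiff_two f,
        testSpace.hasCompactSupport f, testSpace.zero_notMem f, h0.ne', rfl⟩)
      rintro _ ⟨u, -, -, -, -, rfl⟩
      exact div_nonneg (hnum u) (hden u)
  · obtain ⟨f, hf⟩ := testSpace.exists_form_deriv_pos hn hα
    rw [← testSpace.integral_norm_gradient_sq_eq_form] at hf
    exact ⟨_, f, testSpace.contDiff_two f, testSpace.hasCompactSupport f,
      testSpace.zero_notMem f, hf.ne', rfl⟩
  · rintro _ ⟨u, hu, huc, hu0, hne, rfl⟩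
    rw [le_div_iff₀ ((hden u).lt_of_ne hne.symm), integral_norm_gradient_sq _ hu huc hu0,
      integral_lap_sq _ hu]
    exact rellich_of_contDiff hn hα hu huc hu0
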